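/- Let Φ be a Siegel modular form of genus 2 and weight 2k for Sp₄(ℤ), with Fourier expansion Φ(τ₁,z,τ₂) = Σ_{n,m∈ℕ, l∈ℤ, 4nm≥l²} c(n,l,m) q₁ⁿ q₂^m ζ^l. If c(n,l,m) ∈ ℤ for all m ≤ ⌊(k+1)/5⌋, all n ≤ ⌊(k+m)/6⌋ and all l with l² ≤ 4nm, then c(n,l,m) ∈ ℤ for all n,m ∈ ℕ and l ∈ ℤ with 4nm ≥ l². -/

import Mathlib

noncomputable section

open Complex

namespace JacobiPaper

/-- `e2 w = e^{2 π i w}`. -/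
def e2 (w : ℂ) : ℂ := Complex.exp (2 * (Real.pi : ℂ) * Complex.I * w)

/-- `q = e^{2 π i τ}`. -/
def qC (τ : ℂ) : ℂ := e2 τ

/-- `ζ = e^{2 π i z}`. -/
def zetaC (z : ℂ) : ℂ := e2 z

/-- The Dedekind eta function `η(τ) = q^{1/24} ∏_{n ≥ 1} (1 - qⁿ)`. -/
def eta (τ : ℂ) : ℂ :=
  Complex.exp ((Real.pi : ℂ) * Complex.I * τ / 12) * ∏' n : ℕ, (1 - qC τ ^ (n + 1))

/-- The odd Jacobi theta function
`ϑ(τ,z) = q^{1/8} (ζ^{1/2} - ζ^{-1/2}) ∏_{n ≥ 1} (1 - qⁿζ)(1 - qⁿζ⁻¹)(1 - qⁿ)`. -/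
def theta (τ z : ℂ) : ℂ :=
  Complex.exp ((Real.pi : ℂ) * Complex.I * τ / 4) *
    (Complex.exp ((Real.pi : ℂ) * Complex.I * z) - Complex.exp (-((Real.pi : ℂ) * Complex.I * z))) *
    ∏' n : ℕ,
      ((1 - qC τ ^ (n + 1) * zetaC z) * (1 - qC τ ^ (n + 1) * (zetaC z)⁻¹) * (1 - qC τ ^ (n + 1)))

/-- `ϑ₀₀(τ,z) = Σ_{n ∈ ℤ} q^{n²/2} ζⁿ`. -/
def theta00 (τ z : ℂ) : ℂ :=
  ∑' n : ℤ, Complex.exp ((Real.pi : ℂ) * Complex.I * (n : ℂ) ^ 2 * τ +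
    2 * (Real.pi : ℂ) * Complex.I * (n : ℂ) * z)

/-- `ϑ₀₁(τ,z) = Σ_{n ∈ ℤ} (-1)ⁿ q^{n²/2} ζⁿ`. -/
def theta01 (τ z : ℂ) : ℂ :=
  ∑' n : ℤ, (-1 : ℂ) ^ n * Complex.exp ((Real.pi : ℂ) * Complex.I * (n : ℂ) ^ 2 * τ +
    2 * (Real.pi : ℂ) * Complex.I * (n : ℂ) * z)

/-- `ϑ₁₀(τ,z) = q^{1/8} ζ^{1/2} Σ_{n ∈ ℤ} q^{n(n+1)/2} ζⁿ`. -/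
def theta10 (τ z : ℂ) : ℂ :=
  Complex.exp ((Real.pi : ℂ) * Complex.I * τ / 4) * Complex.exp ((Real.pi : ℂ) * Complex.I * z) *
    ∑' n : ℤ, Complex.exp ((Real.pi : ℂ) * Complex.I * (n : ℂ) * ((n : ℂ) + 1) * τ +
      2 * (Real.pi : ℂ) * Complex.I * (n : ℂ) * z)

/-- `ξ₀₀(τ,z) = ϑ₀₀(τ,z)/ϑ₀₀(τ,0)`. -/
def xi00 (τ z : ℂ) : ℂ := theta00 τ z / theta00 τ 0

/-- `ξ₀₁(τ,z) = ϑ₀₁(τ,z)/ϑ₀₁(τ,0)`. -/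
def xi01 (τ z : ℂ) : ℂ := theta01 τ z / theta01 τ 0

/-- `ξ₁₀(τ,z) = ϑ₁₀(τ,z)/ϑ₁₀(τ,0)`. -/
def xi10 (τ z : ℂ) : ℂ := theta10 τ z / theta10 τ 0

/-- The weak Jacobi form `φ_{0,1} = 4(ξ₀₀² + ξ₀₁² + ξ₁₀²)`. -/
def phi01 (τ z : ℂ) : ℂ := 4 * (xi00 τ z ^ 2 + xi01 τ z ^ 2 + xi10 τ z ^ 2)

/-- The weak Jacobi form `φ_{0,2}(τ,z) = 2(ξ₀₀ + ξ₀₁ + ξ₁₀)(τ,2z)`. -/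
def phi02 (τ z : ℂ) : ℂ := 2 * (xi00 τ (2 * z) + xi01 τ (2 * z) + xi10 τ (2 * z))

/-- The weak Jacobi form `φ_{0,3}(τ,z) = ϑ(τ,2z)²/ϑ(τ,z)²`. -/
def phi03 (τ z : ℂ) : ℂ := theta τ (2 * z) ^ 2 / theta τ z ^ 2

/-- The weak Jacobi form `φ_{0,4}(τ,z) = ϑ(τ,3z)/ϑ(τ,z)`. -/
def phi04 (τ z : ℂ) : ℂ := theta τ (3 * z) / theta τ z

/-- The weak Jacobi form `φ_{-2,1}(τ,z) = ϑ(τ,z)²/η(τ)⁶`. -/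
def phiM21 (τ z : ℂ) : ℂ := theta τ z ^ 2 / eta τ ^ 6

/-- The divisor power sum `σ_k(n)`. -/
def sigma' (k n : ℕ) : ℕ := ∑ d ∈ n.divisors, d ^ k

/-- The normalized Eisenstein series `E_k(τ) = 1 - (2k/B_k) Σ_{n ≥ 1} σ_{k-1}(n) qⁿ`. -/
def Eis (k : ℕ) (τ : ℂ) : ℂ :=
  1 - (2 * (k : ℂ) / ((bernoulli k : ℚ) : ℂ)) *
    ∑' n : ℕ, (sigma' (k - 1) (n + 1) : ℂ) * qC τ ^ (n + 1)

/-- The discriminant cusp form `Δ = η²⁴`. -/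
def Delta (τ : ℂ) : ℂ := eta τ ^ 24

/-- The modular invariant `j = E₄³/Δ`. -/
def jInv (τ : ℂ) : ℂ := Eis 4 τ ^ 3 / Delta τ

/-- A choice of `(a, b)` with `a d - b c = 1` completing a coprime pair `(c, d)` to a matrix
`(a b; c d) ∈ SL₂(ℤ)`. -/
def bezout (c d : ℤ) : ℤ × ℤ :=
  haveI : Decidable (∃ ab : ℤ × ℤ, ab.1 * d - ab.2 * c = 1) := Classical.propDecidable _
  if h : ∃ ab : ℤ × ℤ, ab.1 * d - ab.2 * c = 1 then h.choose else 0

/-- The summand `(cτ+d)^{-k} Σ_{l ∈ ℤ} e^{2πim(l²(aτ+b)/(cτ+d) + 2lz/(cτ+d) - cz²/(cτ+d))}`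
of the Jacobi–Eisenstein series attached to a coprime pair `(c,d)`; it does not depend on the
choice of `(a,b)` completing `(c,d)` to an element of `SL₂(ℤ)`. -/
def EisJSummand (k m : ℕ) (τ z : ℂ) (c d : ℤ) : ℂ :=
  ((c : ℂ) * τ + (d : ℂ)) ^ (-(k : ℤ)) *
    ∑' l : ℤ, e2 ((m : ℂ) * ((l : ℂ) ^ 2 * (((bezout c d).1 : ℂ) * τ + ((bezout c d).2 : ℂ)) /
        ((c : ℂ) * τ + (d : ℂ)) +
      2 * (l : ℂ) * z / ((c : ℂ) * τ + (d : ℂ)) - (c : ℂ) * z ^ 2 / ((c : ℂ) * τ + (d : ℂ))))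

/-- The Jacobi–Eisenstein series `E_{k,m}` of weight `k` and index `m`. -/
def EisJ (k m : ℕ) (τ z : ℂ) : ℂ :=
  (1 / 2) * ∑' p : {p : ℤ × ℤ // IsCoprime p.1 p.2}, EisJSummand k m τ z p.1.1 p.1.2

/-- `F_{6,3} = (1/2)(E_{6,1} φ_{0,2} - E₆ φ_{0,3})`. -/
def F63 (τ z : ℂ) : ℂ := (1 / 2) * (EisJ 6 1 τ z * phi02 τ z - Eis 6 τ * phi03 τ z)

/-- A weak Jacobi form of weight `k ∈ ℤ` and index `m ∈ ℕ`: a holomorphic function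
`φ : ℍ × ℂ → ℂ` satisfying the two Jacobi transformation laws and having a Fourier expansion
`φ(τ,z) = Σ_{n ≥ 0, l ∈ ℤ} f(n,l) qⁿ ζˡ`. -/
def IsWeakJacobiForm (k : ℤ) (m : ℕ) (φ : ℂ → ℂ → ℂ) (f : ℕ → ℤ → ℂ) : Prop :=
  DifferentiableOn ℂ (fun p : ℂ × ℂ => φ p.1 p.2) {p : ℂ × ℂ | 0 < p.1.im} ∧
  (∀ a b c d : ℤ, a * d - b * c = 1 → ∀ τ z : ℂ, 0 < τ.im →
    φ (((a : ℂ) * τ + (b : ℂ)) / ((c : ℂ) * τ + (d : ℂ))) (z / ((c : ℂ) * τ + (d : ℂ))) =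
      ((c : ℂ) * τ + (d : ℂ)) ^ k *
        e2 ((m : ℂ) * ((c : ℂ) * z ^ 2 / ((c : ℂ) * τ + (d : ℂ)))) * φ τ z) ∧
  (∀ x y : ℤ, ∀ τ z : ℂ, 0 < τ.im →
    φ τ (z + (x : ℂ) * τ + (y : ℂ)) =
      e2 (-(m : ℂ) * ((x : ℂ) ^ 2 * τ + 2 * (x : ℂ) * z)) * φ τ z) ∧
  (∀ τ z : ℂ, 0 < τ.im →
    HasSum (fun p : ℕ × ℤ => f p.1 p.2 * e2 ((p.1 : ℂ) * τ + (p.2 : ℂ) * z)) (φ τ z))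

/-- A weakly holomorphic Jacobi form of weight `0` and index `m ∈ ℕ`: as a weak Jacobi form,
but the Fourier expansion `φ(τ,z) = Σ_{n ≥ n₀, l ∈ ℤ} f(n,l) qⁿ ζˡ` may contain finitely many
negative powers of `q`. -/
def IsWeaklyHolomorphicJacobiForm0 (m : ℕ) (φ : ℂ → ℂ → ℂ) (f : ℤ → ℤ → ℂ) : Prop :=
  DifferentiableOn ℂ (fun p : ℂ × ℂ => φ p.1 p.2) {p : ℂ × ℂ | 0 < p.1.im} ∧
  (∀ a b c d : ℤ, a * d - b * c = 1 → ∀ τ z : ℂ, 0 < τ.im →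
    φ (((a : ℂ) * τ + (b : ℂ)) / ((c : ℂ) * τ + (d : ℂ))) (z / ((c : ℂ) * τ + (d : ℂ))) =
      e2 ((m : ℂ) * ((c : ℂ) * z ^ 2 / ((c : ℂ) * τ + (d : ℂ)))) * φ τ z) ∧
  (∀ x y : ℤ, ∀ τ z : ℂ, 0 < τ.im →
    φ τ (z + (x : ℂ) * τ + (y : ℂ)) =
      e2 (-(m : ℂ) * ((x : ℂ) ^ 2 * τ + 2 * (x : ℂ) * z)) * φ τ z) ∧
  (∃ n₀ : ℤ, ∀ n : ℤ, n < n₀ → ∀ l : ℤ, f n l = 0) ∧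
  (∀ τ z : ℂ, 0 < τ.im →
    HasSum (fun p : ℤ × ℤ => f p.1 p.2 * e2 ((p.1 : ℂ) * τ + (p.2 : ℂ) * z)) (φ τ z))

/-- A function `φ` on `ℍ × ℂ` has integral Fourier coefficients if it is the sum of a Fourier
series `Σ_{n ≥ 0, l ∈ ℤ} f(n,l) qⁿ ζˡ` with all `f(n,l) ∈ ℤ`. -/
def HasIntegralFourierExpansion (φ : ℂ → ℂ → ℂ) : Prop :=
  ∃ f : ℕ → ℤ → ℤ, ∀ τ z : ℂ, 0 < τ.im →
    HasSum (fun p : ℕ × ℤ => (f p.1 p.2 : ℂ) * e2 ((p.1 : ℂ) * τ + (p.2 : ℂ) * z)) (φ τ z)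

/-- A Siegel modular form of genus `2` and weight `w` for `Sp₄(ℤ)`, written in the coordinates
`Z = (τ₁ z; z τ₂)` of the Siegel upper half-space `ℍ₂`, together with its Fourier expansion
`Φ(τ₁,z,τ₂) = Σ_{n,m ∈ ℕ, l ∈ ℤ, 4nm ≥ l²} c(n,l,m) q₁ⁿ q₂^m ζˡ`. -/
def IsSiegelModularForm2 (w : ℤ) (Φ : ℂ → ℂ → ℂ → ℂ) (c : ℕ → ℤ → ℕ → ℂ) : Prop :=
  DifferentiableOn ℂ (fun p : ℂ × ℂ × ℂ => Φ p.1 p.2.1 p.2.2)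
    {p : ℂ × ℂ × ℂ | 0 < p.1.im ∧ 0 < p.1.im * p.2.2.im - p.2.1.im ^ 2} ∧
  (∀ A B C D : Matrix (Fin 2) (Fin 2) ℤ,
      A.transpose * C = C.transpose * A → B.transpose * D = D.transpose * B → A.transpose * D - C.transpose * B = 1 →
      ∀ τ₁ z τ₂ : ℂ, 0 < τ₁.im → 0 < τ₁.im * τ₂.im - z.im ^ 2 →
      ∀ Z' : Matrix (Fin 2) (Fin 2) ℂ,
        Z' = (A.map (Int.cast : ℤ → ℂ) * !![τ₁, z; z, τ₂] + B.map (Int.cast : ℤ → ℂ)) *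
          (C.map (Int.cast : ℤ → ℂ) * !![τ₁, z; z, τ₂] + D.map (Int.cast : ℤ → ℂ))⁻¹ →
        Φ (Z' 0 0) (Z' 0 1) (Z' 1 1) =
          (C.map (Int.cast : ℤ → ℂ) * !![τ₁, z; z, τ₂] +
            D.map (Int.cast : ℤ → ℂ)).det ^ w * Φ τ₁ z τ₂) ∧
  (∀ n m : ℕ, ∀ l : ℤ, 4 * (n : ℤ) * (m : ℤ) < l ^ 2 → c n l m = 0) ∧
  (∀ τ₁ z τ₂ : ℂ, 0 < τ₁.im → 0 < τ₁.im * τ₂.im - z.im ^ 2 →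
    HasSum (fun p : ℕ × ℤ × ℕ => c p.1 p.2.1 p.2.2 *
      e2 ((p.1 : ℂ) * τ₁ + (p.2.1 : ℂ) * z + (p.2.2 : ℂ) * τ₂)) (Φ τ₁ z τ₂))

/-! ### Exponentials and uniqueness of Fourier coefficients -/

lemma e2_add (a b : ℂ) : e2 (a + b) = e2 a * e2 b := by
  simp only [e2, mul_add, Complex.exp_add]

@[simp] lemma e2_zero : e2 0 = 1 := by simp [e2]

lemma e2_ne_zero (a : ℂ) : e2 a ≠ 0 := Complex.exp_ne_zero _

lemma e2_neg (a : ℂ) : e2 (-a) = (e2 a)⁻¹ := by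
  simp [e2, Complex.exp_neg]

lemma e2_nat_mul (n : ℕ) (a : ℂ) : e2 (n * a) = e2 a ^ n := by
  rw [e2, e2, ← Complex.exp_nat_mul]; congr 1; ring

lemma e2_int_mul (n : ℤ) (a : ℂ) : e2 (n * a) = e2 a ^ n := by
  rw [e2, e2, ← Complex.exp_int_mul]; congr 1; ring

@[simp] lemma e2_int (n : ℤ) : e2 n = 1 := by
  rw [e2, Complex.exp_eq_one_iff]; exact ⟨n, by ring⟩

lemma e2_one : e2 1 = 1 := by simpa using e2_int 1

lemma norm_e2 (a : ℂ) : ‖e2 a‖ = Real.exp (-2 * Real.pi * a.im) := by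
  rw [e2, Complex.norm_exp]; congr 1; simp

lemma norm_e2_real (x : ℝ) : ‖e2 x‖ = 1 := by simp [norm_e2]

lemma continuous_e2 : Continuous e2 := by unfold e2; fun_prop

lemma integral_e2_int (k : ℤ) : ∫ x in (0 : ℝ)..1, e2 (k * x) = if k = 0 then 1 else 0 := by
  split_ifs with h
  · simp [h]
  · have hc : (2 * (Real.pi : ℂ) * Complex.I * k) ≠ 0 := by
      have := Complex.two_pi_I_ne_zero
      simp [h, Real.pi_ne_zero]
    have : ∀ x : ℝ, e2 (k * x) = Complex.exp ((2 * (Real.pi : ℂ) * Complex.I * k) * x) := by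
      intro x; rw [e2]; congr 1; ring
    simp_rw [this]
    rw [integral_exp_mul_complex hc]
    have h1 : Complex.exp ((2 * (Real.pi : ℂ) * Complex.I * k) * (1 : ℝ)) = 1 := by
      have := e2_int k
      rw [e2] at this
      simpa using this
    rw [h1]
    simp

lemma hasSum_of_eq {ι : Type*} {f g : ι → ℂ} {a : ℂ} (hf : HasSum f a)
    (h : ∀ i, g i = f i) : HasSum g a := by
  rwa [show g = f from funext h]

/-- Extracting a Fourier coefficient of an absolutely convergent trigonometric series. -/
lemma hasSum_fourierCoeff {ι : Type*} [Countable ι] {a : ι → ℂ} {k : ι → ℤ} {g : ℝ → ℂ}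
    (h : ∀ x : ℝ, HasSum (fun i => a i * e2 (k i * x)) (g x)) (K : ℤ) :
    HasSum (fun i => if k i = K then a i else 0) (∫ x in (0 : ℝ)..1, g x * e2 (-(K * x))) := by
  have hs : Summable fun i => ‖a i‖ := by
    have := (h 0).summable.norm
    simpa using this
  have key := intervalIntegral.hasSum_integral_of_dominated_convergence
    (μ := MeasureTheory.volume) (a := 0) (b := 1)
    (F := fun i (x : ℝ) => a i * e2 (k i * x) * e2 (-(K * x)))
    (f := fun x => g x * e2 (-(K * x))) (fun i _ => ‖a i‖)
    (fun i => (Continuous.aestronglyMeasurable (by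
      have := continuous_e2
      fun_prop)))
    (fun i => by
      filter_upwards with x _
      have h1 := norm_e2_real (k i * x)
      have h2 := norm_e2_real (-(K * x))
      push_cast at h1 h2
      simp [h1, h2])
    (by filter_upwards with x _ using hs)
    (by simp)
    (by filter_upwards with x _ using (h x).mul_right _)
  have integral_mul_char (i : ι) : (if k i = K then a i else 0) =
      ∫ x in (0 : ℝ)..1, a i * e2 (k i * x) * e2 (-(K * x)) := by
    have : ∀ x : ℝ, a i * e2 (k i * x) * e2 (-(K * x)) = a i * e2 ((k i - K : ℤ) * x) := by
      intro x
      rw [mul_assoc, ← e2_add]; congr 2; push_cast; ring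
    simp_rw [this]
    rw [intervalIntegral.integral_const_mul, integral_e2_int]
    simp [sub_eq_zero]
  have hk : (fun i => if k i = K then a i else 0) =
      fun i => ∫ x in (0 : ℝ)..1, a i * e2 (k i * x) * e2 (-(K * x)) := by
    funext i
    exact integral_mul_char i
  rw [hk]
  exact key

lemma hasSum_fourierCoeff₂ {ι : Type*} [Countable ι] {a : ι → ℂ} {k l : ι → ℤ} {g : ℝ → ℝ → ℂ}
    (h : ∀ x y : ℝ, HasSum (fun i => a i * e2 (k i * x + l i * y)) (g x y)) (K L : ℤ) :
    HasSum (fun i => if k i = K ∧ l i = L then a i else 0)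
      (∫ y in (0 : ℝ)..1, (∫ x in (0 : ℝ)..1, g x y * e2 (-(K * x))) * e2 (-(L * y))) := by
  have h1 : ∀ y : ℝ, HasSum (fun i => (if k i = K then a i else 0) * e2 (l i * y))
      (∫ x in (0 : ℝ)..1, g x y * e2 (-(K * x))) := by
    intro y
    have := hasSum_fourierCoeff (a := fun i => a i * e2 (l i * y)) (k := k)
      (g := fun x => g x y) (fun x => by
        convert h x y using 2 with i
        rw [add_comm, e2_add]; ring) K
    convert this using 2 with i
    split_ifs <;> simp
  convert hasSum_fourierCoeff h1 L using 2 with i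
  by_cases h1 : k i = K <;> by_cases h2 : l i = L <;> simp [h1, h2]

/-! ### Power series over Laurent polynomials and their values -/

abbrev LaurentSeries₂ (R : Type*) [CommRing R] := PowerSeries (LaurentPolynomial R)

/-- The coefficient of `xⁿ yˡ`. -/
def cf {R : Type*} [CommRing R] (F : LaurentSeries₂ R) (n : ℕ) (l : ℤ) : R :=
  (PowerSeries.coeff n F).coeff l

/-- `v` is the (unconditional) value of the double series `F` at the point `(x, y)`. -/
def Ev (F : LaurentSeries₂ ℂ) (x y v : ℂ) : Prop :=
  HasSum (fun p : ℕ × ℤ => cf F p.1 p.2 * (x ^ p.1 * y ^ p.2)) v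

/-- Extension of scalars from `ℤ` to `ℂ`. -/
def toC : LaurentSeries₂ ℤ →+* LaurentSeries₂ ℂ :=
  PowerSeries.map (AddMonoidAlgebra.mapRingHom ℤ (Int.castRingHom ℂ))

lemma cf_toC (F : LaurentSeries₂ ℤ) (n : ℕ) (l : ℤ) : cf (toC F) n l = ((cf F n l : ℤ) : ℂ) := by
  simp [cf, toC]

lemma cf_ext {R : Type*} [CommRing R] {F G : LaurentSeries₂ R} (h : ∀ n l, cf F n l = cf G n l) :
    F = G := by
  ext n l; exact h n l

lemma coeff_eq_zero_iff {R : Type*} [CommRing R] {F : LaurentSeries₂ R} {n : ℕ} :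
    PowerSeries.coeff n F = 0 ↔ ∀ l, cf F n l = 0 := by
  constructor
  · intro h l; simp [cf, h]
  · intro h; ext l; exact h l

@[simp] lemma cf_add {R : Type*} [CommRing R] (F G : LaurentSeries₂ R) (n l) :
    cf (F + G) n l = cf F n l + cf G n l := by simp [cf]
@[simp] lemma cf_sub {R : Type*} [CommRing R] (F G : LaurentSeries₂ R) (n l) :
    cf (F - G) n l = cf F n l - cf G n l := by simp [cf]
@[simp] lemma cf_zero {R : Type*} [CommRing R] (n l) : cf (0 : LaurentSeries₂ R) n l = 0 := by
  simp [cf]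

/-- The constant double series. -/
def cst {R : Type*} [CommRing R] : R →+* LaurentSeries₂ R :=
  (PowerSeries.C).comp LaurentPolynomial.C

@[simp] lemma cf_cst_mul {R : Type*} [CommRing R] (a : R) (F : LaurentSeries₂ R) (n l) :
    cf (cst a * F) n l = a * cf F n l := by
  simp [cf, cst, ← LaurentPolynomial.smul_eq_C_mul]

lemma cf_one {R : Type*} [CommRing R] (n l) :
    cf (1 : LaurentSeries₂ R) n l = if n = 0 ∧ l = 0 then 1 else 0 := by
  rw [cf, PowerSeries.coeff_one]
  by_cases h : n = 0
  · have := LaurentPolynomial.C_apply (1 : R) l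
    rw [map_one] at this
    simp [h, this]
  · simp [h]

lemma cf_X_mul {R : Type*} [CommRing R] (F : LaurentSeries₂ R) (n l) :
    cf (PowerSeries.X * F) n l = if n = 0 then 0 else cf F (n - 1) l := by
  cases n with
  | zero => simp [cf]
  | succ n => simp [cf, PowerSeries.coeff_succ_X_mul]

lemma cf_X_pow_mul {R : Type*} [CommRing R] (F : LaurentSeries₂ R) (d n : ℕ) (l) :
    cf (PowerSeries.X ^ d * F) n l = if d ≤ n then cf F (n - d) l else 0 := by
  rw [cf, PowerSeries.coeff_X_pow_mul']
  split_ifs <;> simp [cf]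

lemma toC_X : toC PowerSeries.X = PowerSeries.X := by simp [toC]

lemma toC_cst (a : ℤ) : toC (cst a) = cst (a : ℂ) := by
  simp [toC, cst, LaurentPolynomial.C]

namespace Ev
variable {F G : LaurentSeries₂ ℂ} {x y u v : ℂ}

lemma add (hF : Ev F x y u) (hG : Ev G x y v) : Ev (F + G) x y (u + v) := by
  unfold Ev
  simpa only [cf_add, add_mul] using HasSum.add hF hG

lemma sub (hF : Ev F x y u) (hG : Ev G x y v) : Ev (F - G) x y (u - v) := by
  unfold Ev
  simpa only [cf_sub, sub_mul] using HasSum.sub hF hG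

lemma cst_mul (a : ℂ) (hF : Ev F x y u) : Ev (cst a * F) x y (a * u) := by
  unfold Ev
  simpa only [cf_cst_mul, mul_assoc] using HasSum.mul_left a hF

lemma one : Ev 1 x y 1 := by
  unfold Ev
  convert hasSum_ite_eq ((0, 0) : ℕ × ℤ) (1 : ℂ) using 2 with p
  obtain ⟨n, l⟩ := p
  simp only [cf_one, Prod.mk.injEq]
  split_ifs with h
  · simp [h.1, h.2]
  · simp

lemma zero : Ev 0 x y 0 := by
  unfold Ev
  simp

lemma X_mul (hF : Ev F x y u) : Ev (PowerSeries.X * F) x y (x * u) := by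
  unfold Ev
  have hi : Function.Injective (fun p : ℕ × ℤ => (p.1 + 1, p.2)) := by
    rintro ⟨a, b⟩ ⟨c, d⟩ h; simpa using h
  rw [← hi.hasSum_iff]
  · refine hasSum_of_eq (HasSum.mul_left x hF) fun p => ?_
    simp [cf_X_mul, pow_succ]; ring
  · rintro ⟨n, l⟩ h
    cases n with
    | zero => simp [cf_X_mul]
    | succ n => exact absurd ⟨(n, l), rfl⟩ h

lemma coeff_mul_hasSum (P Q : LaurentPolynomial ℂ) (L : ℤ) :
    HasSum (fun l => P.coeff l * Q.coeff (L - l)) ((P * Q).coeff L) := by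
  rw [AddMonoidAlgebra.coeff_mul_apply_left, Finsupp.sum]
  convert hasSum_sum_of_ne_finset_zero (f := fun l => P.coeff l * Q.coeff (L - l))
    (s := P.coeff.support) (L := SummationFilter.unconditional ℤ) ?_ using 2 with l
  · rw [neg_add_eq_sub]
  · intro l hl
    simp only [Finsupp.mem_support_iff, not_not] at hl
    simp [hl]

lemma mul (hy : y ≠ 0) (hF : Ev F x y u) (hG : Ev G x y v) : Ev (F * G) x y (u * v) := by
  have hF' : HasSum (fun p : ℕ × ℤ => cf F p.1 p.2 * (x ^ p.1 * y ^ p.2)) u := hF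
  have hG' : HasSum (fun p : ℕ × ℤ => cf G p.1 p.2 * (x ^ p.1 * y ^ p.2)) v := hG
  have h0 := summable_mul_of_summable_norm hF'.summable.norm hG'.summable.norm
  have h1 := hF'.mul hG' h0
  let e : ((ℕ × ℕ) × ℤ) × ℤ ≃ (ℕ × ℤ) × (ℕ × ℤ) :=
    { toFun := fun p => ((p.1.1.1, p.2), (p.1.1.2, p.1.2 - p.2))
      invFun := fun p => (((p.1.1, p.2.1), p.1.2 + p.2.2), p.1.2)
      left_inv := by rintro ⟨⟨⟨a, b⟩, c⟩, d⟩; simp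
      right_inv := by rintro ⟨⟨a, b⟩, ⟨c, d⟩⟩; simp }
  have h2 := (e.hasSum_iff.2 h1).prod_fiberwise (g := fun p =>
    (PowerSeries.coeff p.1.1 F * PowerSeries.coeff p.1.2 G).coeff p.2 *
      (x ^ (p.1.1 + p.1.2) * y ^ p.2)) (by
    rintro ⟨⟨n, n'⟩, L⟩
    convert (coeff_mul_hasSum (PowerSeries.coeff n F) (PowerSeries.coeff n' G) L).mul_right
      (x ^ (n + n') * y ^ L) using 2 with l
    simp only [e, Function.comp, Equiv.coe_fn_mk, cf]
    have : y ^ L = y ^ l * y ^ (L - l) := by rw [← zpow_add₀ hy]; congr 1; ring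
    rw [this, pow_add]
    ring)
  let e' : (Σ p : ℕ × ℤ, Finset.HasAntidiagonal.antidiagonal p.1) ≃ (ℕ × ℕ) × ℤ :=
    { toFun := fun p => (p.2.1, p.1.2)
      invFun := fun p => ⟨(p.1.1 + p.1.2, p.2), ⟨p.1, by simp⟩⟩
      left_inv := by
        rintro ⟨⟨n, l⟩, ⟨⟨a, b⟩, h⟩⟩
        simp only [Finset.HasAntidiagonal.mem_antidiagonal] at h
        subst h
        rfl
      right_inv := by rintro ⟨⟨a, b⟩, c⟩; rfl }
  have h3 := (e'.hasSum_iff.2 h2).sigma (g := fun p => cf (F * G) p.1 p.2 * (x ^ p.1 * y ^ p.2)) (by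
    rintro ⟨n, l⟩
    convert hasSum_fintype _ using 1
    simp only [cf, PowerSeries.coeff_mul, e', Function.comp, Equiv.coe_fn_mk]
    rw [Finset.sum_coe_sort (Finset.HasAntidiagonal.antidiagonal n) (fun p =>
      (PowerSeries.coeff p.1 F * PowerSeries.coeff p.2 G).coeff l * (x ^ (p.1 + p.2) * y ^ l))]
    rw [AddMonoidAlgebra.coeff_sum, Finsupp.finsetSum_apply, Finset.sum_mul]
    refine Finset.sum_congr rfl fun p hp => ?_
    rw [Finset.HasAntidiagonal.mem_antidiagonal.1 hp]
    · infer_instance)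
  exact h3

lemma pow (hy : y ≠ 0) (hF : Ev F x y u) (n : ℕ) : Ev (F ^ n) x y (u ^ n) := by
  induction n with
  | zero => simpa using one
  | succ n ih => rw [pow_succ, pow_succ]; exact ih.mul hy hF

end Ev

/-! ### Symmetric Laurent polynomials and their moments -/

section Symmetric
variable {R : Type*} [CommRing R]
open LaurentPolynomial

/-- The symmetric Laurent polynomial `T - 2 + T⁻¹`. -/
def symS (R : Type*) [CommRing R] : LaurentPolynomial R := T 1 - C 2 + T (-1)

/-- Substitution of `T - 2 + T⁻¹` in a polynomial. -/
def sig : Polynomial R →+* LaurentPolynomial R := Polynomial.eval₂RingHom C (symS R)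

@[simp] lemma sig_X : sig (Polynomial.X : Polynomial R) = symS R := by simp [sig]
@[simp] lemma sig_C (a : R) : sig (Polynomial.C a) = C a := by simp [sig]

lemma coeff_symS_mul (P : LaurentPolynomial R) (l : ℤ) :
    (symS R * P).coeff l = P.coeff (l - 1) - 2 * P.coeff l + P.coeff (l + 1) := by
  have h1 (n : ℤ) : (T n * P).coeff l = P.coeff (-n + l) := by
    rw [T, AddMonoidAlgebra.coeff_single_mul_apply, one_mul]
  have h2 : (C 2 * P).coeff l = 2 * P.coeff l := by
    rw [← smul_eq_C_mul]; simp
  rw [symS, add_mul, sub_mul, AddMonoidAlgebra.coeff_add, AddMonoidAlgebra.coeff_sub,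
    Finsupp.add_apply, Finsupp.sub_apply, h1, h1, h2]
  rw [neg_add_eq_sub, neg_neg, add_comm 1 l]

lemma coeff_symS_pow (m : ℕ) : (∀ l : ℤ, (m : ℤ) < |l| → (symS R ^ m).coeff l = 0) ∧
    (symS R ^ m).coeff m = 1 ∧ ∀ l, (symS R ^ m).coeff (-l) = (symS R ^ m).coeff l := by
  induction m with
  | zero =>
    have h (l : ℤ) : ((1 : LaurentPolynomial R)).coeff l = if l = 0 then 1 else 0 := by
      rw [← map_one C, C_apply]
    refine ⟨fun l hl => ?_, by simp [h], fun l => by simp [h]⟩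
    have : l ≠ 0 := by rintro rfl; simp at hl
    simp [h, this]
  | succ m ih =>
    obtain ⟨h1, h2, h3⟩ := ih
    simp only [pow_succ', coeff_symS_mul]
    refine ⟨fun l hl => ?_, ?_, fun l => ?_⟩
    · push_cast at hl
      rw [h1, h1, h1] <;> first | ring1 | grind
    · rw [show ((m + 1 : ℕ) : ℤ) - 1 = m by push_cast; ring, h2, h1, h1]
      · ring
      · push_cast; rw [abs_of_nonneg] <;> omega
      · push_cast; rw [abs_of_nonneg] <;> omega
    · rw [h3 l, show -l - 1 = -(l + 1) by ring, show -l + 1 = -(l - 1) by ring, h3, h3]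
      ring

lemma exists_sig_eq (m : ℕ) : ∀ P : LaurentPolynomial R, (∀ l : ℤ, (m : ℤ) < |l| → P.coeff l = 0) →
    (∀ l, P.coeff (-l) = P.coeff l) → ∃ Q : Polynomial R, Q.natDegree ≤ m ∧ P = sig Q := by
  induction m with
  | zero =>
    intro P h _
    refine ⟨Polynomial.C (P.coeff 0), by simp, ?_⟩
    ext l
    rw [sig_C, C_apply]
    split_ifs with hl
    · rw [hl]
    · exact h l (by simpa using hl)
  | succ m ih =>
    intro P h hs
    obtain ⟨h1, h2, h3⟩ := coeff_symS_pow (R := R) (m + 1)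
    have hc (l : ℤ) : (P - C (P.coeff (m + 1 : ℕ)) * symS R ^ (m + 1)).coeff l =
        P.coeff l - P.coeff (m + 1 : ℕ) * (symS R ^ (m + 1)).coeff l := by
      rw [AddMonoidAlgebra.coeff_sub, ← smul_eq_C_mul]; simp
    obtain ⟨Q, hQ, hPQ⟩ := ih (P - C (P.coeff (m + 1 : ℕ)) * symS R ^ (m + 1))
      (fun l hl => by
        rw [hc]
        by_cases h' : ((m + 1 : ℕ) : ℤ) < |l|
        · rw [h l h', h1 l h']; ring
        · have : |l| = (m + 1 : ℕ) := by push_cast at h' ⊢; omega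
          rcases abs_eq (by positivity) |>.1 this with rfl | rfl
          · rw [h2]; ring
          · rw [h3, hs, h2]; ring)
      (fun l => by rw [hc, hc, hs, h3])
    refine ⟨Q + Polynomial.C (P.coeff (m + 1 : ℕ)) * Polynomial.X ^ (m + 1), ?_, ?_⟩
    · refine (Polynomial.natDegree_add_le _ _).trans (max_le (by omega) ?_)
      exact Polynomial.natDegree_C_mul_X_pow_le _ _
    · rw [map_add, ← hPQ, map_mul, map_pow, sig_X, sig_C]; ring

end Symmetric

section Moments
open PowerSeries

/-- The Taylor expansion of a Laurent polynomial at `T = exp X`. -/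
def tay : LaurentPolynomial ℂ →ₐ[ℂ] PowerSeries ℂ :=
  AddMonoidAlgebra.lift ℂ (PowerSeries ℂ) ℤ
    { toFun := fun n => rescale ((Multiplicative.toAdd n : ℤ) : ℂ) (exp ℂ)
      map_one' := by simp
      map_mul' := fun a b => by
        rw [exp_mul_exp_eq_exp_add]; simp }

lemma coeff_tay (P : LaurentPolynomial ℂ) (r : ℕ) :
    coeff r (tay P) = P.coeff.sum fun l a => a * ((l : ℂ) ^ r / (r.factorial : ℂ)) := by
  rw [tay, AddMonoidAlgebra.lift_apply, Finsupp.sum, map_sum]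
  refine Finset.sum_congr rfl fun l _ => ?_
  simp [coeff_rescale, coeff_exp, div_eq_mul_inv]

lemma coeff_tay_of_odd {P : LaurentPolynomial ℂ} (h : ∀ l, P.coeff (-l) = P.coeff l) {r : ℕ}
    (hr : Odd r) : coeff r (tay P) = 0 := by
  have h1 : P.coeff.sum (fun l a => a * ((l : ℂ) ^ r / (r.factorial : ℂ))) =
      - P.coeff.sum (fun l a => a * ((l : ℂ) ^ r / (r.factorial : ℂ))) := by
    conv_lhs => rw [Finsupp.sum]
    rw [Finsupp.sum, ← Finset.sum_neg_distrib]
    refine Finset.sum_nbij' (fun l => -l) (fun l => -l) ?_ ?_ ?_ ?_ ?_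
    · intro l; simp [h]
    · intro l; simp [h]
    · simp
    · simp
    · intro l _
      rw [h, Int.cast_neg, hr.neg_pow]; ring
  rw [coeff_tay]
  exact self_eq_neg.1 h1

lemma tay_symS : ∃ u : PowerSeries ℂ, constantCoeff u = 1 ∧ tay (symS ℂ) = X ^ 2 * u := by
  have hc (r : ℕ) : coeff r (tay (symS ℂ)) =
      (1 / (r.factorial : ℂ)) - (if r = 0 then 2 else 0) + (-1) ^ r / (r.factorial : ℂ) := by
    have hT (n : ℤ) : tay (LaurentPolynomial.T n) = rescale (n : ℂ) (exp ℂ) := by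
      rw [tay, LaurentPolynomial.T, AddMonoidAlgebra.lift_single]; simp
    have hC : tay (LaurentPolynomial.C 2) = C 2 := by
      rw [LaurentPolynomial.C_eq_algebraMap, AlgHom.commutes]; rfl
    rw [symS, map_add, map_sub, hT, hT, hC]
    simp [coeff_rescale, coeff_exp, coeff_C, div_eq_mul_inv]
  have hd : X ^ 2 ∣ tay (symS ℂ) := by
    rw [X_pow_dvd_iff]
    intro r hr
    rw [hc]
    interval_cases r <;> norm_num
  obtain ⟨u, hu⟩ := hd
  refine ⟨u, ?_, hu⟩
  have := hc 2
  rw [hu, show (2 : ℕ) = 0 + 2 by rfl, coeff_X_pow_mul] at this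
  rw [← coeff_zero_eq_constantCoeff_apply, this]
  norm_num [Nat.factorial]

lemma constantCoeff_tay_sig (Q : Polynomial ℂ) : constantCoeff (tay (sig Q)) = Q.coeff 0 := by
  obtain ⟨u, hu, hs⟩ := tay_symS
  have : (constantCoeff.comp ((tay : _ →+* _).comp sig)) = Polynomial.constantCoeff (R := ℂ) := by
    apply Polynomial.ringHom_ext
    · intro a
      have : tay (LaurentPolynomial.C a) = C a := by
        rw [LaurentPolynomial.C_eq_algebraMap, AlgHom.commutes]; rfl
      simp [this]
    · simp [hs]
  exact RingHom.congr_fun this Q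

lemma tay_sig_of_X_pow {Q : Polynomial ℂ} {a : ℕ} (h : ∀ j < a, Q.coeff j = 0) :
    (∀ r < 2 * a, coeff r (tay (sig Q)) = 0) ∧ coeff (2 * a) (tay (sig Q)) = Q.coeff a := by
  obtain ⟨u, hu, hs⟩ := tay_symS
  obtain ⟨Q', rfl⟩ := Polynomial.X_pow_dvd_iff.2 h
  have : tay (sig (Polynomial.X ^ a * Q')) = X ^ (2 * a) * (u ^ a * tay (sig Q')) := by
    rw [map_mul, map_mul, map_pow, map_pow, sig_X, hs]; ring
  rw [this]
  refine ⟨fun r hr => by rw [coeff_X_pow_mul', if_neg (by omega)], ?_⟩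
  rw [coeff_X_pow_mul', if_pos le_rfl, Nat.sub_self, coeff_zero_eq_constantCoeff_apply, map_mul,
    map_pow, hu, constantCoeff_tay_sig, Polynomial.coeff_X_pow_mul']
  simp

lemma coeff_eq_zero_of_tay {Q : Polynomial ℂ} {a : ℕ}
    (h : ∀ r < 2 * a, coeff r (tay (sig Q)) = 0) : ∀ j < a, Q.coeff j = 0 := by
  intro j
  induction j using Nat.strong_induction_on with
  | _ j ih =>
    intro hj
    rw [← (tay_sig_of_X_pow (a := j) fun i hi => ih i hi (hi.trans hj)).2]
    exact h _ (by omega)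

end Moments

/-! ### Jacobi forms with their expansions -/

/-- Two expansions of the same function have the same Fourier coefficients. -/
lemma tsum_fourier_eq {ι κ : Type} [Countable ι] [Countable κ] {a : ι → ℂ} {b : κ → ℂ}
    {k l : ι → ℤ} {k' l' : κ → ℤ} {g : ℂ → ℂ → ℂ}
    (ha : ∀ τ z : ℂ, 0 < τ.im → HasSum (fun i => a i * e2 (k i * τ + l i * z)) (g τ z))
    (hb : ∀ τ z : ℂ, 0 < τ.im → HasSum (fun j => b j * e2 (k' j * τ + l' j * z)) (g τ z))
    (K L : ℤ) :
    ∑' i, (if k i = K ∧ l i = L then a i else 0) = ∑' j, (if k' j = K ∧ l' j = L then b j else 0) := by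
  have key {ι : Type} [Countable ι] {a : ι → ℂ} {k l : ι → ℤ}
      (ha : ∀ τ z : ℂ, 0 < τ.im → HasSum (fun i => a i * e2 (k i * τ + l i * z)) (g τ z)) :
      HasSum (fun i => if k i = K ∧ l i = L then a i else 0)
        ((∫ y in (0 : ℝ)..1, (∫ x in (0 : ℝ)..1, g (x + I) y * e2 (-(K * x))) * e2 (-(L * y))) *
          e2 (-(K * I))) := by
    have h := hasSum_fourierCoeff₂ (a := fun i => a i * e2 (k i * I)) (k := k) (l := l)
      (g := fun x y => g (x + I) y) (fun x y => by
        refine hasSum_of_eq (ha (x + I) y (by simp)) fun i => ?_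
        rw [mul_assoc, ← e2_add]; congr 2; ring) K L
    refine hasSum_of_eq (h.mul_right (e2 (-(K * I)))) fun i => ?_
    split_ifs with hi
    · rw [hi.1, mul_assoc, ← e2_add]; simp
    · simp
  rw [(key ha).tsum_eq, (key hb).tsum_eq]

/-- `f` satisfies the transformation laws of an even Jacobi form of weight `w` and index `m`
under the generators of the Jacobi group, and has the expansion `F`. -/
structure IsJ (w : ℤ) (m : ℕ) (f : ℂ → ℂ → ℂ) (F : LaurentSeries₂ ℂ) : Prop where
  ev : ∀ τ z : ℂ, 0 < τ.im → Ev F (e2 τ) (e2 z) (f τ z)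
  inv : ∀ τ z : ℂ, 0 < τ.im → f (-1 / τ) (z / τ) = τ ^ w * e2 (m * z ^ 2 / τ) * f τ z
  ell : ∀ τ z : ℂ, 0 < τ.im → f τ (z + τ) = e2 (-(m * (τ + 2 * z))) * f τ z
  par : ∀ τ z : ℂ, 0 < τ.im → f τ (-z) = f τ z

lemma e2_lin (n : ℕ) (l : ℤ) (τ z : ℂ) : e2 τ ^ n * e2 z ^ l = e2 ((n : ℤ) * τ + l * z) := by
  rw [e2_add, e2_int_mul, e2_int_mul, zpow_natCast]

lemma ne_zero_of_im_pos {τ : ℂ} (h : 0 < τ.im) : τ ≠ 0 := by rintro rfl; simp at h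

namespace IsJ
variable {w w' : ℤ} {m m' : ℕ} {f f' : ℂ → ℂ → ℂ} {F F' : LaurentSeries₂ ℂ}

lemma expansion (h : IsJ w m f F) (τ z : ℂ) (hτ : 0 < τ.im) :
    HasSum (fun p : ℕ × ℤ => cf F p.1 p.2 * e2 ((p.1 : ℤ) * τ + p.2 * z)) (f τ z) := by
  refine hasSum_of_eq (h.ev τ z hτ) fun p => ?_
  rw [e2_lin]

lemma mul (h : IsJ w m f F) (h' : IsJ w' m' f' F') :
    IsJ (w + w') (m + m') (fun τ z => f τ z * f' τ z) (F * F') where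
  ev τ z hτ := (h.ev τ z hτ).mul (e2_ne_zero _) (h'.ev τ z hτ)
  inv τ z hτ := by
    rw [h.inv τ z hτ, h'.inv τ z hτ, zpow_add₀ (ne_zero_of_im_pos hτ), Nat.cast_add, add_mul, add_div, e2_add]
    ring
  ell τ z hτ := by
    rw [h.ell τ z hτ, h'.ell τ z hτ, Nat.cast_add, add_mul, neg_add, e2_add]
    ring
  par τ z hτ := by rw [h.par τ z hτ, h'.par τ z hτ]

lemma add (h : IsJ w m f F) (h' : IsJ w m f' F') :
    IsJ w m (fun τ z => f τ z + f' τ z) (F + F') where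
  ev τ z hτ := (h.ev τ z hτ).add (h'.ev τ z hτ)
  inv τ z hτ := by rw [h.inv τ z hτ, h'.inv τ z hτ]; ring
  ell τ z hτ := by rw [h.ell τ z hτ, h'.ell τ z hτ]; ring
  par τ z hτ := by rw [h.par τ z hτ, h'.par τ z hτ]

lemma smul (a : ℂ) (h : IsJ w m f F) : IsJ w m (fun τ z => a * f τ z) (cst a * F) where
  ev τ z hτ := (h.ev τ z hτ).cst_mul a
  inv τ z hτ := by rw [h.inv τ z hτ]; ring
  ell τ z hτ := by rw [h.ell τ z hτ]; ring
  par τ z hτ := by rw [h.par τ z hτ]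

lemma sub (h : IsJ w m f F) (h' : IsJ w m f' F') :
    IsJ w m (fun τ z => f τ z - f' τ z) (F - F') where
  ev τ z hτ := (h.ev τ z hτ).sub (h'.ev τ z hτ)
  inv τ z hτ := by rw [h.inv τ z hτ, h'.inv τ z hτ]; ring
  ell τ z hτ := by rw [h.ell τ z hτ, h'.ell τ z hτ]; ring
  par τ z hτ := by rw [h.par τ z hτ, h'.par τ z hτ]

lemma zero : IsJ w m (fun _ _ => 0) 0 := ⟨fun _ _ _ => Ev.zero, by simp, by simp, by simp⟩

lemma one : IsJ 0 0 (fun _ _ => 1) 1 := ⟨fun _ _ _ => Ev.one, by simp, by simp, by simp⟩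

lemma cf_neg (h : IsJ w m f F) (n : ℕ) (l : ℤ) : cf F n (-l) = cf F n l := by
  have := tsum_fourier_eq (g := f) (a := fun p : ℕ × ℤ => cf F p.1 p.2)
    (b := fun p : ℕ × ℤ => cf F p.1 p.2) (k := fun p => p.1) (l := fun p => p.2) (k' := fun p => p.1)
    (l' := fun p => -p.2) h.expansion (fun τ z hτ => by
      rw [← h.par τ z hτ]
      refine hasSum_of_eq (h.expansion τ (-z) hτ) fun p => ?_
      push_cast; congr 2; ring) n (-l)
  rw [tsum_eq_single (n, -l), tsum_eq_single (n, l)] at this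
  · simpa using this
  · rintro ⟨n', l'⟩ hne
    rw [if_neg]
    rintro ⟨h1, h2⟩
    exact hne (by simp at h1 h2; simp [h1, h2])
  · rintro ⟨n', l'⟩ hne
    rw [if_neg]
    rintro ⟨h1, h2⟩
    exact hne (by simp at h1 h2; simp [h1, h2])

lemma cf_eq_zero (h : IsJ w m f F) {n : ℕ} (hn : ∀ i < n, ∀ l, cf F i l = 0) {l : ℤ}
    (hl : (m : ℤ) < |l|) : cf F n l = 0 := by
  wlog hl0 : 0 ≤ l with H
  · rw [← h.cf_neg]
    exact H h hn (by rwa [abs_neg]) (by omega)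
  rw [abs_of_nonneg hl0] at hl
  have := tsum_fourier_eq (g := fun τ z => f τ (z + τ)) (a := fun p : ℕ × ℤ => cf F p.1 p.2)
    (b := fun p : ℕ × ℤ => cf F p.1 p.2) (k := fun p => p.1 + p.2) (l := fun p => p.2)
    (k' := fun p => p.1 - m)
    (l' := fun p => p.2 - 2 * m) (fun τ z hτ => by
      refine hasSum_of_eq (h.expansion τ (z + τ) hτ) fun p => ?_
      push_cast; congr 2; ring) (fun τ z hτ => by
      rw [h.ell τ z hτ]
      refine hasSum_of_eq ((h.expansion τ z hτ).mul_left _) fun p => ?_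
      rw [mul_left_comm, ← e2_add]
      push_cast; congr 2; ring) (n - m) (l - 2 * m)
  symm at this
  rw [tsum_eq_single (n, l) (by
    rintro ⟨n', l'⟩ hne
    rw [if_neg]
    rintro ⟨h1, h2⟩
    exact hne (by simp at h1 h2; simp [h1, h2])), if_pos (by simp)] at this
  refine this.trans ?_
  refine (tsum_congr (g := fun _ => 0) fun p => ?_).trans tsum_zero
  split_ifs with hp
  · exact hn _ (by omega) _
  · rfl

/-- The leading coefficient of a Jacobi form is a polynomial of degree at most the index in
`T - 2 + T⁻¹`. -/
lemma exists_leading {R : Type*} [CommRing R] (h : IsJ w m f F) {n : ℕ}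
    (hn : ∀ i < n, ∀ l, cf F i l = 0) {φ : R →+* ℂ} (hφ : Function.Injective φ)
    {P : LaurentPolynomial R} (hP : ∀ l, cf F n l = φ (P.coeff l)) :
    ∃ Q : Polynomial R, Q.natDegree ≤ m ∧ P = sig Q := by
  refine exists_sig_eq m P (fun l hl => ?_) (fun l => ?_)
  · apply hφ; rw [← hP, map_zero]; exact h.cf_eq_zero hn hl
  · apply hφ; rw [← hP, ← hP, h.cf_neg]

end IsJ

/-! ### Vanishing of modular forms -/

section Modular
open scoped MatrixGroups Manifold ModularForm
open UpperHalfPlane hiding I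

lemma differentiableOn_of_hasSum_e2 {a : ℕ → ℂ} {g : ℂ → ℂ}
    (ha : ∀ τ : ℂ, 0 < τ.im → HasSum (fun n => a n * e2 τ ^ n) (g τ)) :
    DifferentiableOn ℂ g {τ | 0 < τ.im} := by
  intro τ hτ
  have hτ : 0 < τ.im := hτ
  have hopen : IsOpen {z : ℂ | τ.im / 2 < z.im} := isOpen_lt continuous_const Complex.continuous_im
  have hs := (ha (((τ.im / 2 : ℝ) : ℂ) * I) (by simp; linarith)).summable.norm
  have h := Complex.differentiableOn_tsum_of_summable_norm (F := fun n z => a n * e2 z ^ n) hs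
    (fun n => by unfold e2; fun_prop) hopen (fun n z hz => by
      rw [norm_mul, norm_mul, norm_pow, norm_pow, norm_e2, norm_e2]
      refine mul_le_mul_of_nonneg_left (pow_le_pow_left₀ (Real.exp_pos _).le
        (Real.exp_le_exp.2 ?_) n) (norm_nonneg _)
      have hz : τ.im / 2 < z.im := hz
      have h2 := Real.pi_pos
      simp
      nlinarith only [hz, h2])
  have hd := h.differentiableAt (hopen.mem_nhds (show τ.im / 2 < τ.im by linarith))
  refine (hd.congr_of_eventuallyEq ?_).differentiableWithinAt
  filter_upwards [hopen.mem_nhds (show τ.im / 2 < τ.im by linarith)] with z hz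
  have hz : τ.im / 2 < z.im := hz
  exact ((ha z (by linarith)).tsum_eq).symm

/-- A modular form of level one, given by its `q`-expansion and its behaviour under inversion. -/
lemma exists_modularForm {w : ℤ} {a : ℕ → ℂ} {g : ℂ → ℂ}
    (ha : ∀ τ : ℂ, 0 < τ.im → HasSum (fun n => a n * e2 τ ^ n) (g τ))
    (hg : ∀ τ : ℂ, 0 < τ.im → g (-1 / τ) = τ ^ w * g τ) :
    ∃ f : ModularForm 𝒮ℒ w, ∀ n, (qExpansion 1 f).coeff n = a n := by
  have hq (τ : ℍ) : HasSum (fun m ↦ a m • Function.Periodic.qParam 1 τ ^ m) (g τ) := by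
    refine hasSum_of_eq (ha τ τ.im_pos) fun m => ?_
    simp [Function.Periodic.qParam, e2]
  have hS : ((fun τ : ℍ => g τ) ∣[w] ModularGroup.S) = fun τ : ℍ => g τ := by
    ext τ
    have h := hg τ τ.im_pos
    rw [ModularForm.SL_slash_apply, UpperHalfPlane.modular_S_smul]
    have h0 : (τ : ℂ) ^ w ≠ 0 := zpow_ne_zero _ τ.ne_zero
    have h1 : (-1 : ℂ) / τ = (-(τ : ℂ))⁻¹ := by rw [neg_div, one_div, inv_neg]
    rw [h1] at h
    rw [ModularGroup.denom_S]
    change g ((-(τ : ℂ))⁻¹) * _ = g τ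
    rw [h, zpow_neg]
    field_simp
  have hT : ((fun τ : ℍ => g τ) ∣[w] ModularGroup.T) = fun τ : ℍ => g τ := by
    ext τ
    have hden : denom ModularGroup.T τ = 1 := by
      have e (i j : Fin 2) : (Matrix.SpecialLinearGroup.toGL ((Matrix.SpecialLinearGroup.map (Int.castRingHom ℝ))
        ModularGroup.T)) i j = ((ModularGroup.T i j : ℤ) : ℝ) := rfl
      rw [denom, e, e]
      simp [ModularGroup.T]
    rw [ModularForm.SL_slash_apply, hden, modular_T_smul]
    have h1 : g (1 + (τ : ℂ)) = g τ := by
      refine (ha (1 + τ) (by simpa using τ.im_pos)).unique (hasSum_of_eq (ha τ τ.im_pos) fun n => ?_)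
      rw [e2_add, e2_one, one_mul]
    simpa using h1
  have hb : IsBoundedAtImInfty (fun τ : ℍ => g τ) :=
    isBoundedAtImInfty_of_hasSum_qExpansion one_pos hq
  let f : ModularForm 𝒮ℒ w :=
    { toFun := fun τ => g τ
      slash_action_eq' := by
        rintro A ⟨A, rfl⟩
        exact SlashInvariantForm.slash_action_generators_SL2Z hS hT A
      holo' := by
        rw [UpperHalfPlane.mdifferentiable_iff]
        refine (differentiableOn_of_hasSum_e2 ha).congr fun z hz => ?_
        simp [ofComplex_apply_of_im_pos hz]
      bdd_at_cusps' := fun hc => by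
        rw [Subgroup.IsArithmetic.isCusp_iff_isCusp_SL2Z] at hc
        rw [OnePoint.isBoundedAt_iff_forall_SL2Z hc]
        intro γ _
        rw [SlashInvariantForm.slash_action_generators_SL2Z hS hT]
        exact hb }
  refine ⟨f, fun n => ?_⟩
  exact (ModularFormClass.qExpansion_coeff_unique (f := f) one_pos one_mem_strictPeriods_SL hq n).symm

lemma qExpansion_eq_zero_of_vanishing {w : ℤ} {N : ℕ} (hw : w < 12 * N ∨ w = 12 * N + 2)
    (f : ModularForm 𝒮ℒ w) (hf : ∀ i < N, (qExpansion 1 f).coeff i = 0) :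
    qExpansion 1 f = 0 := by
  induction N generalizing w with
  | zero =>
    have hf0 : (f : ℍ → ℂ) = 0 := by
      rcases hw with hw | rfl
      · exact ModularFormClass.levelOne_neg_weight_eq_zero (by simpa using hw) f
      · simpa using congrArg (fun f : ModularForm 𝒮ℒ _ => (f : ℍ → ℂ))
          (rank_zero_iff_forall_zero.mp ModularForm.levelOne_weight_two_rank_zero f)
    rw [hf0]; exact UpperHalfPlane.qExpansion_zero 1
  | succ N ih =>
    have h0 := hf 0 (by omega)
    have hfac := ModularForm.qExpansion_eq_qExpansion_discriminant_mul f h0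
    obtain ⟨D, hD⟩ : PowerSeries.X ∣ qExpansion 1 ModularForm.discriminant := by
      rw [PowerSeries.X_dvd_iff, ← PowerSeries.coeff_zero_eq_constantCoeff_apply]
      apply PowerSeries.coeff_of_lt_order
      rw [ModularForm.discriminant_qExpansion_order]; simp
    have hD0 : PowerSeries.constantCoeff D ≠ 0 := by
      have := ModularForm.discriminant_qExpansion_coeff_one
      rw [hD, PowerSeries.coeff_succ_X_mul, PowerSeries.coeff_zero_eq_constantCoeff_apply] at this
      simp [this]
    rw [hfac, ih (by push_cast at hw; omega) (CuspForm.discriminantEquiv (ModularForm.toCuspForm f h0)), mul_zero]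
    have hdvd : PowerSeries.X ^ (N + 1) ∣ qExpansion 1 f := PowerSeries.X_pow_dvd_iff.2 hf
    rw [hfac, hD, pow_succ', mul_assoc] at hdvd
    have h2 := (mul_dvd_mul_iff_left PowerSeries.X_ne_zero).1 hdvd
    have hu : IsUnit D := by rw [PowerSeries.isUnit_iff_constantCoeff]; exact isUnit_iff_ne_zero.2 hD0
    rw [hu.dvd_mul_left] at h2
    exact PowerSeries.X_pow_dvd_iff.1 h2

lemma modular_vanishing {w : ℤ} {N : ℕ} (hw : w < 12 * N ∨ w = 12 * N + 2) {a : ℕ → ℂ} {g : ℂ → ℂ}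
    (ha : ∀ τ : ℂ, 0 < τ.im → HasSum (fun n => a n * e2 τ ^ n) (g τ))
    (hg : ∀ τ : ℂ, 0 < τ.im → g (-1 / τ) = τ ^ w * g τ) (h0 : ∀ i < N, a i = 0) (n : ℕ) :
    a n = 0 := by
  obtain ⟨f, hf⟩ := exists_modularForm ha hg
  rw [← hf, qExpansion_eq_zero_of_vanishing hw f fun i hi => by rw [hf, h0 i hi], map_zero]

end Modular

/-! ### Taylor coefficients of Jacobi forms -/

/-- The lowest Taylor coefficient of an everywhere convergent power series as a limit. -/
lemma tendsto_div_pow {c : ℕ → ℂ} {g : ℂ → ℂ} (h : ∀ z, HasSum (fun r => c r * z ^ r) (g z)) {N : ℕ}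
    (hc : ∀ r < N, c r = 0) :
    Filter.Tendsto (fun z => g z / z ^ N) (nhdsWithin 0 {0}ᶜ) (nhds (c N)) := by
  let G : ℂ → ℂ := fun z => if z = 0 then c N else g z / z ^ N
  have hG : HasFPowerSeriesAt G (FormalMultilinearSeries.ofScalars ℂ fun r => c (r + N)) 0 := by
    rw [hasFPowerSeriesAt_iff]
    refine Filter.Eventually.of_forall fun z => ?_
    simp only [FormalMultilinearSeries.coeff_ofScalars, zero_add, smul_eq_mul]
    by_cases hz : z = 0
    · subst hz
      simp only [G, if_true]
      refine hasSum_of_eq (hasSum_ite_eq 0 (c N)) fun r => ?_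
      by_cases hr : r = 0
      · simp [hr]
      · simp [hr]
    · simp only [G, hz, if_false]
      have h1 := (hasSum_nat_add_iff' N).2 (h z)
      rw [Finset.sum_eq_zero (fun i hi => by rw [hc i (Finset.mem_range.1 hi), zero_mul]), sub_zero] at h1
      refine hasSum_of_eq (h1.div_const (z ^ N)) fun r => ?_
      rw [pow_add]
      field_simp
  have := hG.continuousAt.tendsto
  simp only [G, if_true] at this
  refine (this.mono_left nhdsWithin_le_nhds).congr' ?_
  filter_upwards [self_mem_nhdsWithin] with z hz
  exact if_neg hz

namespace IsJ
variable {w : ℤ} {m : ℕ} {f : ℂ → ℂ → ℂ} {F : LaurentSeries₂ ℂ}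

lemma summable_taylor (h : IsJ w m f F) {τ : ℂ} (hτ : 0 < τ.im) (z : ℂ) :
    Summable fun p : (ℕ × ℤ) × ℕ =>
      cf F p.1.1 p.1.2 * e2 τ ^ p.1.1 * ((2 * Real.pi * I * (p.1.2 * z)) ^ p.2 / (p.2.factorial : ℂ)) := by
  have hexp (p : ℕ × ℤ) : HasSum (fun r : ℕ => ‖cf F p.1 p.2 * e2 τ ^ p.1‖ *
      ((2 * Real.pi * (|(p.2 : ℝ)| * ‖z‖)) ^ r / (r.factorial : ℝ)))
      (‖cf F p.1 p.2 * e2 τ ^ p.1‖ * Real.exp (2 * Real.pi * (|(p.2 : ℝ)| * ‖z‖))) := by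
    have := NormedSpace.expSeries_div_hasSum_exp (2 * Real.pi * (|(p.2 : ℝ)| * ‖z‖))
    rw [← Real.exp_eq_exp_ℝ] at this
    exact this.mul_left _
  refine Summable.of_norm ?_
  have hnorm (p : (ℕ × ℤ) × ℕ) : ‖cf F p.1.1 p.1.2 * e2 τ ^ p.1.1 *
      ((2 * Real.pi * I * (p.1.2 * z)) ^ p.2 / (p.2.factorial : ℂ))‖ =
      ‖cf F p.1.1 p.1.2 * e2 τ ^ p.1.1‖ *
      ((2 * Real.pi * (|(p.1.2 : ℝ)| * ‖z‖)) ^ p.2 / (p.2.factorial : ℝ)) := by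
    rw [norm_mul, norm_div, norm_pow]
    simp [abs_of_pos Real.pi_pos]
  simp_rw [hnorm]
  rw [summable_prod_of_nonneg (fun p => by positivity)]
  refine ⟨fun p => (hexp p).summable, ?_⟩
  simp_rw [fun p => (hexp p).tsum_eq]
  have hs (s : ℝ) := (h.ev τ (s * I) hτ).summable.norm
  refine Summable.of_nonneg_of_le (fun p => by positivity) (fun p => ?_) ((hs ‖z‖).add (hs (-‖z‖)))
  have hn (s : ℝ) : ‖cf F p.1 p.2 * (e2 τ ^ p.1 * e2 (s * I) ^ p.2)‖ =
      ‖cf F p.1 p.2 * e2 τ ^ p.1‖ * Real.exp (-2 * Real.pi * (p.2 * s)) := by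
    rw [← mul_assoc, norm_mul, ← e2_int_mul, norm_e2]
    simp
  rw [hn, hn, ← mul_add]
  refine mul_le_mul_of_nonneg_left ?_ (norm_nonneg _)
  rcases abs_choice (p.2 : ℝ) with ha | ha
  · rw [ha]
    refine le_add_of_nonneg_of_le (Real.exp_pos _).le (Real.exp_le_exp.2 (le_of_eq ?_))
    ring
  · rw [ha]
    refine le_add_of_le_of_nonneg (Real.exp_le_exp.2 (le_of_eq ?_)) (Real.exp_pos _).le
    ring

lemma exists_taylor (h : IsJ w m f F) : ∃ C : ℕ → ℂ → ℂ, ∀ τ : ℂ, 0 < τ.im →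
    (∀ r, HasSum (fun n => ((2 * Real.pi * I) ^ r * PowerSeries.coeff r (tay (PowerSeries.coeff n F))) *
      e2 τ ^ n) (C r τ)) ∧ ∀ z, HasSum (fun r => C r τ * z ^ r) (f τ z) := by
  let t (τ : ℂ) (p : (ℕ × ℤ) × ℕ) : ℂ := cf F p.1.1 p.1.2 * e2 τ ^ p.1.1 *
    ((2 * Real.pi * I * p.1.2) ^ p.2 / (p.2.factorial : ℂ))
  refine ⟨fun r τ => ∑' p, t τ (p, r), fun τ hτ => ?_⟩
  have hs : Summable (t τ) := by
    refine (h.summable_taylor hτ 1).congr fun p => ?_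
    simp [t]
  have hsr (r : ℕ) : Summable fun p => t τ (p, r) :=
    hs.comp_injective (i := fun p => (p, r)) fun p q hpq => by simpa using hpq
  constructor
  · intro r
    refine (hsr r).hasSum.prod_fiberwise fun n => ?_
    rw [coeff_tay, Finsupp.sum]
    have hfin := hasSum_sum_of_ne_finset_zero (f := fun l => t τ ((n, l), r))
      (s := (PowerSeries.coeff n F).coeff.support) (L := SummationFilter.unconditional ℤ) (fun l hl => by
        simp only [Finsupp.mem_support_iff, not_not] at hl
        simp [t, cf, hl])
    convert hfin using 1
    rw [Finset.mul_sum, Finset.sum_mul]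
    refine Finset.sum_congr rfl fun l _ => ?_
    simp only [t, cf]
    ring
  · intro z
    let tz (p : (ℕ × ℤ) × ℕ) : ℂ := t τ p * z ^ p.2
    have hz : Summable tz := by
      refine (h.summable_taylor hτ z).congr fun p => ?_
      simp only [tz, t]
      ring
    have h1 : HasSum tz (f τ z) := by
      have h2 := hz.hasSum.prod_fiberwise (g := fun p => cf F p.1 p.2 * (e2 τ ^ p.1 * e2 z ^ p.2))
        (fun p => by
          have := (NormedSpace.expSeries_div_hasSum_exp (2 * Real.pi * I * (p.2 * z))).mul_left
            (cf F p.1 p.2 * e2 τ ^ p.1)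
          rw [← Complex.exp_eq_exp_ℂ] at this
          rw [← mul_assoc, ← e2_int_mul]
          refine hasSum_of_eq this fun r => ?_
          simp only [tz, t]
          ring)
      rw [(h.ev τ z hτ).unique h2]
      exact hz.hasSum
    have h3 := ((Equiv.prodComm _ _).hasSum_iff.2 h1).prod_fiberwise
      (g := fun r => (∑' p, t τ (p, r)) * z ^ r) (fun r => by
        refine hasSum_of_eq ((hsr r).hasSum.mul_right (z ^ r)) fun p => ?_
        simp [tz])
    exact h3

/-- The first possibly non-vanishing Taylor coefficient of a Jacobi form is a modular form, and
vanishes if its `q`-expansion starts late enough. -/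
lemma tay_eq_zero (h : IsJ w m f F) {j N : ℕ}
    (hlow : ∀ i, ∀ r < 2 * j, PowerSeries.coeff r (tay (PowerSeries.coeff i F)) = 0)
    (hN : ∀ i < N, PowerSeries.coeff (2 * j) (tay (PowerSeries.coeff i F)) = 0)
    (hw : w + 2 * j < 12 * N ∨ w + 2 * j = 12 * N + 2) (i : ℕ) :
    ∀ r < 2 * (j + 1), PowerSeries.coeff r (tay (PowerSeries.coeff i F)) = 0 := by
  obtain ⟨C, hC⟩ := h.exists_taylor
  have hC0 (τ : ℂ) (hτ : 0 < τ.im) (r : ℕ) (hr : r < 2 * j) : C r τ = 0 :=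
    ((hC τ hτ).1 r).unique (by simp [hlow _ r hr])
  have hlim (τ : ℂ) (hτ : 0 < τ.im) := tendsto_div_pow (hC τ hτ).2 (hC0 τ hτ)
  have hmod (τ : ℂ) (hτ : 0 < τ.im) : C (2 * j) (-1 / τ) = τ ^ (w + 2 * j) * C (2 * j) τ := by
    have hτ0 := ne_zero_of_im_pos hτ
    have hτ' : 0 < (-1 / τ).im := by
      rw [neg_div, one_div, Complex.neg_im, Complex.inv_im, neg_div, neg_neg]
      exact div_pos hτ (Complex.normSq_pos.2 hτ0)
    have hdiv : Filter.Tendsto (fun z => z / τ) (nhdsWithin 0 {0}ᶜ) (nhdsWithin 0 {0}ᶜ) := by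
      refine tendsto_nhdsWithin_iff.2 ⟨?_, ?_⟩
      · have : Continuous fun z : ℂ => z / τ := by fun_prop
        simpa using (this.tendsto 0).mono_left nhdsWithin_le_nhds
      · filter_upwards [self_mem_nhdsWithin] with z hz
        exact div_ne_zero hz hτ0
    have h1 := (hlim _ hτ').comp hdiv
    have he : Filter.Tendsto (fun z => e2 (m * z ^ 2 / τ)) (nhdsWithin 0 {0}ᶜ) (nhds 1) := by
      have : Continuous fun z : ℂ => e2 (m * z ^ 2 / τ) := by unfold e2; fun_prop
      simpa using (this.tendsto 0).mono_left nhdsWithin_le_nhds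
    have h2 := (he.mul (hlim τ hτ)).const_mul (τ ^ (w + 2 * j))
    rw [one_mul] at h2
    refine tendsto_nhds_unique h1 (h2.congr' ?_)
    filter_upwards [self_mem_nhdsWithin] with z hz
    have hz : z ≠ 0 := hz
    simp only [Function.comp]
    rw [h.inv τ z hτ, zpow_add₀ hτ0, div_pow]
    have : τ ^ (2 * (j : ℤ)) = τ ^ (2 * j) := by norm_cast
    rw [this]
    field_simp
  intro r hr
  rcases lt_trichotomy r (2 * j) with h1 | rfl | h1
  · exact hlow i r h1
  · have := modular_vanishing hw (fun τ hτ => (hC τ hτ).1 (2 * j)) hmod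
      (fun i hi => by rw [hN i hi, mul_zero]) i
    exact (mul_eq_zero.1 this).resolve_left (pow_ne_zero _ Complex.two_pi_I_ne_zero)
  · obtain rfl : r = 2 * j + 1 := by omega
    exact coeff_tay_of_odd (h.cf_neg i) ⟨j, rfl⟩

end IsJ

/-! ### Theta functions -/

lemma jacobiTheta₂_add_nat (u τ : ℂ) (n : ℕ) : jacobiTheta₂ (u + n) τ = jacobiTheta₂ u τ := by
  induction n with
  | zero => simp
  | succ n ih => rw [Nat.cast_succ, ← add_assoc, jacobiTheta₂_add_left, ih]

lemma jacobiTheta₂_add_nat_mul (u τ : ℂ) (n : ℕ) :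
    jacobiTheta₂ (u + n * τ) τ = e2 (-(n ^ 2 * τ / 2 + n * u)) * jacobiTheta₂ u τ := by
  induction n with
  | zero => simp
  | succ n ih =>
    have : u + (n + 1 : ℕ) * τ = (u + n * τ) + τ := by push_cast; ring
    rw [this, jacobiTheta₂_add_left', ih, ← mul_assoc]
    congr 1
    rw [e2, e2, ← Complex.exp_add]
    congr 1
    push_cast; ring

lemma jacobiTheta₂_add_one_right (u τ : ℂ) : jacobiTheta₂ u (τ + 1) = jacobiTheta₂ (u + 1 / 2) τ := by
  refine tsum_congr fun n => ?_
  obtain ⟨k, hk⟩ : Even (n * (n - 1)) := Int.even_mul_pred_self n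
  have hk : (n : ℂ) * (n - 1) = k + k := by exact_mod_cast hk
  have h : 2 * Real.pi * I * n * u + Real.pi * I * n ^ 2 * (τ + 1) =
      (2 * Real.pi * I * n * (u + 1 / 2) + Real.pi * I * n ^ 2 * τ) + 2 * Real.pi * I * k := by
    linear_combination (Real.pi * I) * hk
  have h1 := e2_int k
  rw [e2] at h1
  rw [jacobiTheta₂_term, jacobiTheta₂_term, h, Complex.exp_add, h1, mul_one]

lemma jacobiTheta₂_inv (u : ℂ) {τ : ℂ} (hτ : τ ≠ 0) :
    jacobiTheta₂ (u / τ) (-1 / τ) =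
      (-I * τ) ^ (1 / 2 : ℂ) * e2 (u ^ 2 / (2 * τ)) * jacobiTheta₂ u τ := by
  have h0 : (-I * τ) ^ (1 / 2 : ℂ) ≠ 0 := by
    rw [Complex.cpow_ne_zero_iff]; left; simp [hτ]
  have h1 : Complex.exp (-Real.pi * I * u ^ 2 / τ) * e2 (u ^ 2 / (2 * τ)) = 1 := by
    rw [e2, ← Complex.exp_add, Complex.exp_eq_one_iff]
    refine ⟨0, ?_⟩
    field_simp
    ring
  rw [jacobiTheta₂_functional_equation u τ]
  generalize Complex.exp (-Real.pi * I * u ^ 2 / τ) = A at *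
  generalize (-I * τ) ^ (1 / 2 : ℂ) = s at *
  generalize jacobiTheta₂ (u / τ) (-1 / τ) = J
  generalize e2 (u ^ 2 / (2 * τ)) = E at *
  field_simp
  linear_combination -J * h1

lemma e2_half : e2 (1 / 2) = -1 := by
  rw [e2, ← Complex.exp_pi_mul_I]; congr 1; ring

lemma e2_sub_half (a : ℂ) : e2 (a - 1 / 2) = -e2 a := by
  rw [sub_eq_add_neg, e2_add, e2_neg, e2_half]; norm_num

lemma e2_sub_quarter (a : ℂ) : e2 (a - 1 / 4) = -I * e2 a := by
  have h : -I = e2 (-(1 / 4)) := by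
    rw [e2, show 2 * Real.pi * I * (-(1 / 4)) = -(Real.pi / 2 * I) by ring, Complex.exp_neg,
      Complex.exp_pi_div_two_mul_I, Complex.inv_I]
  rw [h, sub_eq_add_neg, e2_add, mul_comm]

lemma e2_nat_div_two (n : ℕ) : e2 (n / 2) = (-1) ^ n := by
  rw [← e2_half, ← e2_nat_mul]; congr 1; ring

/-- The theta function in the variable `v z`. -/
def th3 (v : ℕ) (τ z : ℂ) : ℂ := jacobiTheta₂ (v * z) τ
/-- A theta function with characteristics. -/
def th4 (v : ℕ) (τ z : ℂ) : ℂ := jacobiTheta₂ (v * z + 1 / 2) τ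
/-- A theta function with characteristics. -/
def th2 (v : ℕ) (τ z : ℂ) : ℂ :=
  e2 (τ / 8 + v * z / 2) * jacobiTheta₂ (v * z + τ / 2) τ
/-- A theta function with characteristics. -/
def th1 (τ z : ℂ) : ℂ :=
  e2 (τ / 8 + z / 2) * jacobiTheta₂ (z + τ / 2 + 1 / 2) τ

section laws
variable (v : ℕ) (τ z : ℂ)

lemma th3_T : th3 v (τ + 1) z = th4 v τ z := by
  rw [th3, th4, jacobiTheta₂_add_one_right]
lemma th4_T : th4 v (τ + 1) z = th3 v τ z := by
  rw [th3, th4, jacobiTheta₂_add_one_right, show v * z + 1 / 2 + 1 / 2 = v * z + 1 by ring,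
    jacobiTheta₂_add_left]
lemma th2_T : th2 v (τ + 1) z = e2 (1 / 8) * th2 v τ z := by
  rw [th2, th2, jacobiTheta₂_add_one_right, ← jacobiTheta₂_add_left (v * z + τ / 2), ← mul_assoc, ← e2_add]
  congr 2 <;> ring
lemma th1_T : th1 (τ + 1) z = e2 (1 / 8) * th1 τ z := by
  rw [th1, th1, jacobiTheta₂_add_one_right, ← jacobiTheta₂_add_left (z + τ / 2 + 1 / 2), ← mul_assoc, ← e2_add]
  congr 2 <;> ring

lemma th3_add_one : th3 v τ (z + 1) = th3 v τ z := by
  rw [th3, th3, mul_add, mul_one, jacobiTheta₂_add_nat]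
lemma th4_add_one : th4 v τ (z + 1) = th4 v τ z := by
  rw [th4, th4, show v * (z + 1) + 1 / 2 = v * z + 1 / 2 + v by ring, jacobiTheta₂_add_nat]
lemma th2_add_one : th2 v τ (z + 1) = (-1) ^ v * th2 v τ z := by
  rw [th2, th2, ← jacobiTheta₂_add_nat (v * z + τ / 2) _ v, ← e2_nat_div_two, ← mul_assoc, ← e2_add]
  congr 2 <;> ring
lemma th1_add_one : th1 τ (z + 1) = - th1 τ z := by
  rw [th1, th1, ← jacobiTheta₂_add_left (z + τ / 2 + 1 / 2), ← neg_mul, ← neg_one_mul, ← e2_half, ← e2_add]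
  congr 2 <;> ring

lemma th3_neg : th3 v τ (-z) = th3 v τ z := by
  rw [th3, th3, mul_neg, jacobiTheta₂_neg_left]
lemma th4_neg : th4 v τ (-z) = th4 v τ z := by
  rw [th4, th4, ← jacobiTheta₂_neg_left, ← jacobiTheta₂_add_left]; congr 1; ring
lemma th2_neg : th2 v τ (-z) = th2 v τ z := by
  have h := jacobiTheta₂_add_nat_mul (v * z - τ / 2) τ 1
  rw [th2, th2, ← jacobiTheta₂_neg_left (v * -z + τ / 2),
    show (v * z + τ / 2 : ℂ) = v * z - τ / 2 + (1 : ℕ) * τ by push_cast; ring, h, ← mul_assoc, ← e2_add]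
  congr 2 <;> push_cast <;> ring
lemma th1_neg : th1 τ (-z) = - th1 τ z := by
  have h := jacobiTheta₂_add_nat_mul (z - τ / 2 - 1 / 2) τ 1
  have h1 : jacobiTheta₂ (z + τ / 2 + 1 / 2) τ =
      jacobiTheta₂ (z - τ / 2 - 1 / 2 + (1 : ℕ) * τ) τ := by
    rw [← jacobiTheta₂_add_left (z - τ / 2 - 1 / 2 + _)]; congr 1; push_cast; ring
  have h2 : jacobiTheta₂ (-z + τ / 2 + 1 / 2) τ = jacobiTheta₂ (z - τ / 2 - 1 / 2) τ := by
    rw [← jacobiTheta₂_neg_left]; congr 1; ring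
  rw [th1, th1, h1, h, h2, ← neg_mul, ← e2_sub_half, ← mul_assoc, ← e2_add]
  congr 2; push_cast; ring

/-- The multiplier of theta functions under `z ↦ z + τ`. -/
def ellFactor : ℂ := e2 (-(τ / 2 + z))

lemma th3_add : th3 v τ (z + τ) = ellFactor τ z ^ v ^ 2 * th3 v τ z := by
  rw [th3, th3, mul_add, jacobiTheta₂_add_nat_mul, ellFactor, ← e2_nat_mul]
  congr 2; push_cast; ring
lemma th4_add : th4 v τ (z + τ) = (-1) ^ v * ellFactor τ z ^ v ^ 2 * th4 v τ z := by
  have h : ((-1) ^ v : ℂ) = e2 (-(v / 2)) := by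
    rw [e2_neg, e2_nat_div_two, ← inv_pow]; norm_num
  rw [th4, th4, show v * (z + τ) + 1 / 2 = v * z + 1 / 2 + v * τ by ring, jacobiTheta₂_add_nat_mul,
    ellFactor, ← e2_nat_mul, h, ← e2_add]
  congr 2; push_cast; ring
lemma th2_add : th2 v τ (z + τ) = ellFactor τ z ^ v ^ 2 * th2 v τ z := by
  rw [th2, th2, show v * (z + τ) + τ / 2 = v * z + τ / 2 + v * τ by ring, jacobiTheta₂_add_nat_mul,
    ellFactor, ← e2_nat_mul, ← mul_assoc, ← mul_assoc, ← e2_add, ← e2_add]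
  congr 2; push_cast; ring
lemma th1_add : th1 τ (z + τ) = - (ellFactor τ z * th1 τ z) := by
  rw [th1, th1, show z + τ + τ / 2 + 1 / 2 = z + τ / 2 + 1 / 2 + (1 : ℕ) * τ by push_cast; ring,
    jacobiTheta₂_add_nat_mul, ellFactor, ← mul_assoc, ← mul_assoc, ← e2_add, ← e2_add, ← neg_mul,
    ← e2_sub_half]
  congr 2; push_cast; ring

/-- The square root of `-iτ` appearing in the inversion formula. -/
def invFactor : ℂ := (-I * τ) ^ (1 / 2 : ℂ)

/-- The exponential factor of theta functions under inversion. -/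
def invExp : ℂ := e2 (z ^ 2 / (2 * τ))

lemma invFactor_sq : invFactor τ ^ 2 = -I * τ := by
  rw [invFactor, ← Complex.cpow_nat_mul]; norm_num

variable {τ}

lemma th3_inv (hτ : τ ≠ 0) : th3 v (-1 / τ) (z / τ) = invFactor τ * invExp τ z ^ v ^ 2 * th3 v τ z := by
  rw [th3, th3, ← mul_div_assoc, jacobiTheta₂_inv _ hτ, invFactor, invExp, ← e2_nat_mul]
  congr 3; push_cast; ring
lemma th4_inv (hτ : τ ≠ 0) : th4 v (-1 / τ) (z / τ) = invFactor τ * invExp τ z ^ v ^ 2 * th2 v τ z := by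
  rw [th4, th2, show v * (z / τ) + 1 / 2 = (v * z + τ / 2) / τ by field_simp,
    jacobiTheta₂_inv _ hτ, invFactor, invExp, ← e2_nat_mul, mul_assoc, mul_assoc, ← mul_assoc (e2 _) (e2 _),
    ← e2_add]
  congr 3; push_cast; field_simp; ring
lemma th2_inv (hτ : τ ≠ 0) : th2 v (-1 / τ) (z / τ) = invFactor τ * invExp τ z ^ v ^ 2 * th4 v τ z := by
  rw [th4, th2, show v * (z / τ) + -1 / τ / 2 = (v * z - 1 / 2) / τ by field_simp; ring,
    jacobiTheta₂_inv _ hτ, invFactor, invExp, ← e2_nat_mul, ← jacobiTheta₂_add_left (v * z - 1 / 2),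
    ← mul_assoc, mul_left_comm, ← e2_add]
  congr 1
  · congr 2; push_cast; field_simp; ring
  · congr 1; ring
lemma th1_inv (hτ : τ ≠ 0) : th1 (-1 / τ) (z / τ) = -I * invFactor τ * invExp τ z * th1 τ z := by
  have h1 : jacobiTheta₂ (z / τ + -1 / τ / 2 + 1 / 2) (-1 / τ) =
      invFactor τ * e2 ((z + τ / 2 - 1 / 2) ^ 2 / (2 * τ)) * jacobiTheta₂ (z + τ / 2 + 1 / 2) τ := by
    rw [show z / τ + -1 / τ / 2 + 1 / 2 = (z + τ / 2 - 1 / 2) / τ by field_simp; ring,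
      jacobiTheta₂_inv _ hτ, invFactor, ← jacobiTheta₂_add_left (z + τ / 2 - 1 / 2)]
    congr 2; ring
  have h2 : e2 (-1 / τ / 8 + z / τ / 2) * e2 ((z + τ / 2 - 1 / 2) ^ 2 / (2 * τ)) =
      -I * (invExp τ z * e2 (τ / 8 + z / 2)) := by
    rw [invExp, ← e2_add, ← e2_add, ← e2_sub_quarter]
    congr 1; field_simp; ring
  rw [th1, th1, h1]
  linear_combination (invFactor τ * jacobiTheta₂ (z + τ / 2 + 1 / 2) τ) * h2

end laws

/-! ### Integral expansions of theta functions -/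

open LaurentPolynomial in
/-- The series `∑ₖ aₖ x^{Nₖ} y^{lₖ}`, for exponents `Nₖ` growing at least linearly. -/
def thetaSer (N : ℤ → ℕ) (l a : ℤ → ℤ) : LaurentSeries₂ ℤ :=
  PowerSeries.mk fun n => ∑ k ∈ (Finset.Icc (-(n + 1 : ℤ)) (n + 1)).filter (fun k => N k = n),
    C (a k) * T (l k)

lemma cf_thetaSer {N : ℤ → ℕ} (l a : ℤ → ℤ) (n : ℕ) (L : ℤ) :
    cf (thetaSer N l a) n L =
      ∑ k ∈ (Finset.Icc (-(n + 1 : ℤ)) (n + 1)).filter (fun k => N k = n ∧ l k = L), a k := by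
  rw [cf, thetaSer, PowerSeries.coeff_mk, AddMonoidAlgebra.coeff_sum, Finsupp.finsetSum_apply,
    ← Finset.filter_filter, Finset.sum_filter (fun k => l k = L)]
  refine Finset.sum_congr rfl fun k _ => ?_
  rw [← LaurentPolynomial.single_eq_C_mul_T, AddMonoidAlgebra.coeff_single, Finsupp.single_apply]

lemma ev_thetaSer {N : ℤ → ℕ} {l a : ℤ → ℤ} (hN : ∀ k, |k| ≤ N k + 1) {x y v : ℂ}
    (h : HasSum (fun k => (a k : ℂ) * (x ^ N k * y ^ l k)) v) : Ev (toC (thetaSer N l a)) x y v := by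
  refine ((Equiv.sigmaFiberEquiv fun k => (N k, l k)).hasSum_iff.2 h).sigma fun p => ?_
  obtain ⟨n, L⟩ := p
  have h1 : HasSum (Set.indicator {k | (N k, l k) = (n, L)} fun k => (a k : ℂ) * (x ^ N k * y ^ l k))
      (∑ k ∈ (Finset.Icc (-(n + 1 : ℤ)) (n + 1)).filter (fun k => N k = n ∧ l k = L),
        (a k : ℂ) * (x ^ n * y ^ L)) := by
    convert hasSum_sum_of_ne_finset_zero (L := SummationFilter.unconditional ℤ) ?_ using 1
    · refine Finset.sum_congr rfl fun k hk => ?_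
      obtain ⟨-, h1, h2⟩ := Finset.mem_filter.1 hk
      rw [Set.indicator_of_mem (by simp [h1, h2]), h1, h2]
    · intro k hk
      refine Set.indicator_of_notMem (fun h => hk ?_) _
      simp only [Set.mem_ofPred_eq, Prod.mk.injEq] at h
      have := abs_le.1 (hN k)
      rw [h.1] at this
      simp only [Finset.mem_filter, Finset.mem_Icc, h, and_self, and_true]
      omega
  rw [cf_toC, cf_thetaSer, Int.cast_sum, Finset.sum_mul]
  exact (hasSum_subtype_iff_indicator (s := {k | (N k, l k) = (n, L)})).2 h1

/-- `F` is the integral expansion of `f` in `e2 (τ / 8)` and `e2 (z / 2)`. -/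
def HasZ (F : LaurentSeries₂ ℤ) (f : ℂ → ℂ → ℂ) : Prop :=
  ∀ τ z : ℂ, 0 < τ.im → Ev (toC F) (e2 (τ / 8)) (e2 (z / 2)) (f τ z)

namespace HasZ
variable {F G : LaurentSeries₂ ℤ} {f g : ℂ → ℂ → ℂ}

lemma add (hF : HasZ F f) (hG : HasZ G g) : HasZ (F + G) (fun τ z => f τ z + g τ z) :=
  fun τ z hτ => by rw [map_add]; exact (hF τ z hτ).add (hG τ z hτ)
lemma sub (hF : HasZ F f) (hG : HasZ G g) : HasZ (F - G) (fun τ z => f τ z - g τ z) :=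
  fun τ z hτ => by rw [map_sub]; exact (hF τ z hτ).sub (hG τ z hτ)
lemma mul (hF : HasZ F f) (hG : HasZ G g) : HasZ (F * G) (fun τ z => f τ z * g τ z) :=
  fun τ z hτ => by rw [map_mul]; exact (hF τ z hτ).mul (e2_ne_zero _) (hG τ z hτ)
lemma pow (hF : HasZ F f) (n : ℕ) : HasZ (F ^ n) (fun τ z => f τ z ^ n) :=
  fun τ z hτ => by rw [map_pow]; exact (hF τ z hτ).pow (e2_ne_zero _) n
lemma zmul (a : ℤ) (hF : HasZ F f) : HasZ (cst a * F) (fun τ z => a * f τ z) :=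
  fun τ z hτ => by rw [map_mul, toC_cst]; exact (hF τ z hτ).cst_mul _
lemma half (hF : HasZ (2 * F) f) : HasZ F (fun τ z => f τ z / 2) := fun τ z hτ => by
  have h := (hF τ z hτ).cst_mul (1 / 2)
  have h2 : cst (1 / 2 : ℂ) * toC (2 * F) = toC F := by
    have : (2 : LaurentSeries₂ ℂ) = cst 2 := (map_ofNat cst 2).symm
    rw [map_mul, map_ofNat, this, ← mul_assoc, ← map_mul]
    norm_num
  rw [h2] at h
  convert h using 1
  ring

end HasZ

/-- Expansion of `th3 v`. -/
def S3 (v : ℕ) : LaurentSeries₂ ℤ := thetaSer (fun k => (2 * k).natAbs ^ 2) (fun k => 2 * k * v) 1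
/-- Expansion of `th4 v`. -/
def S4 (v : ℕ) : LaurentSeries₂ ℤ :=
  thetaSer (fun k => (2 * k).natAbs ^ 2) (fun k => 2 * k * v) (fun k => (k.negOnePow : ℤ))
/-- Expansion of `th2 v`, up to a factor `X`. -/
def S2 (v : ℕ) : LaurentSeries₂ ℤ :=
  thetaSer (fun k => (4 * (k * (k + 1))).natAbs) (fun k => v * (2 * k + 1)) 1
/-- Expansion of `th1`, up to a factor `X`. -/
def S1 : LaurentSeries₂ ℤ :=
  thetaSer (fun k => (4 * (k * (k + 1))).natAbs) (fun k => 2 * k + 1) (fun k => (k.negOnePow : ℤ))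
/-- Half the expansion of `th2 0`, up to a factor `X`. -/
def St : LaurentSeries₂ ℤ :=
  thetaSer (fun k => (4 * (k * (k + 1))).natAbs) (fun _ => 0) (fun k => if 0 ≤ k then 1 else 0)

lemma abs_le_even (k : ℤ) : |k| ≤ ((2 * k).natAbs ^ 2 : ℕ) + 1 := by
  push_cast
  rw [sq_abs]
  rcases abs_cases k with h | h <;> rw [h.1] <;> nlinarith

lemma abs_le_odd (k : ℤ) : |k| ≤ ((4 * (k * (k + 1))).natAbs : ℕ) + 1 := by
  push_cast
  have := le_abs_self (4 * (k * (k + 1)))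
  rcases abs_cases k with h | h <;> rw [h.1] <;> nlinarith

lemma pow_even (k : ℤ) (a : ℂ) : e2 a ^ ((2 * k).natAbs ^ 2) = e2 (4 * k ^ 2 * a) := by
  rw [← e2_nat_mul, Nat.cast_pow, Nat.cast_natAbs]
  congr 2
  rw [← Int.cast_pow, sq_abs]
  push_cast; ring

lemma pow_odd (k : ℤ) (a : ℂ) :
    e2 a ^ ((4 * (k * (k + 1))).natAbs) = e2 (4 * (k * (k + 1)) * a) := by
  have h : 0 ≤ 4 * (k * (k + 1)) := by
    have := mul_self_nonneg (2 * k + 1)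
    rcases le_or_gt 0 k with h | h <;> nlinarith
  rw [← e2_nat_mul, Nat.cast_natAbs, abs_of_nonneg h]
  push_cast; rfl

lemma negOnePow_eq_e2 (k : ℤ) : ((k.negOnePow : ℤ) : ℂ) = e2 (k * (1 / 2)) := by
  rw [e2_int_mul, e2_half, Int.cast_negOnePow]

lemma hasSum_theta (u : ℂ) {τ : ℂ} (hτ : 0 < τ.im) :
    HasSum (fun k : ℤ => e2 (k * u + k ^ 2 * τ / 2)) (jacobiTheta₂ u τ) := by
  refine hasSum_of_eq (hasSum_jacobiTheta₂_term u hτ) fun k => ?_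
  rw [e2, jacobiTheta₂_term]; congr 1; ring

lemma hasZ_S3 (v : ℕ) : HasZ (S3 v) (th3 v) := fun τ z hτ => by
  refine ev_thetaSer abs_le_even (hasSum_of_eq (hasSum_theta _ hτ) fun k => ?_)
  rw [pow_even, ← e2_int_mul, ← e2_add, Pi.one_apply, Int.cast_one, one_mul]
  congr 1; push_cast; ring

lemma hasZ_S4 (v : ℕ) : HasZ (S4 v) (th4 v) := fun τ z hτ => by
  refine ev_thetaSer abs_le_even (hasSum_of_eq (hasSum_theta _ hτ) fun k => ?_)
  rw [pow_even, ← e2_int_mul, ← e2_add, negOnePow_eq_e2, ← e2_add]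
  congr 1; push_cast; ring

lemma hasZ_S2 (v : ℕ) : HasZ (PowerSeries.X * S2 v) (th2 v) := fun τ z hτ => by
  rw [map_mul, toC_X]
  have h1 := (hasSum_theta (v * z + τ / 2) hτ).mul_left (e2 (v * z / 2))
  have h := (ev_thetaSer (x := e2 (τ / 8)) (y := e2 (z / 2)) abs_le_odd
    (l := fun k => v * (2 * k + 1)) (a := 1) (hasSum_of_eq h1 fun k => ?_)).X_mul
  · rwa [← mul_assoc, ← e2_add] at h
  · rw [pow_odd, ← e2_int_mul, ← e2_add, Pi.one_apply, Int.cast_one, one_mul, ← e2_add]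
    congr 1; push_cast; ring

lemma hasZ_S1 : HasZ (PowerSeries.X * S1) th1 := fun τ z hτ => by
  rw [map_mul, toC_X]
  have h1 := (hasSum_theta (z + τ / 2 + 1 / 2) hτ).mul_left (e2 (z / 2))
  have h := (ev_thetaSer (x := e2 (τ / 8)) (y := e2 (z / 2)) abs_le_odd
    (l := fun k => 2 * k + 1) (a := fun k => (k.negOnePow : ℤ)) (hasSum_of_eq h1 fun k => ?_)).X_mul
  · rwa [← mul_assoc, ← e2_add] at h
  · rw [pow_odd, ← e2_int_mul, ← e2_add, negOnePow_eq_e2, ← e2_add, ← e2_add]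
    congr 1; push_cast; ring

lemma two_mul_St : 2 * St = S2 0 := by
  refine cf_ext fun n L => ?_
  have h2 : (2 : LaurentSeries₂ ℤ) = cst 2 := by simp
  rw [h2, cf_cst_mul, St, S2, cf_thetaSer, cf_thetaSer, ← Finset.sum_filter]
  simp only [Finset.filter_filter, Pi.one_apply, Finset.sum_const, nsmul_eq_mul, mul_one]
  set s := Finset.Icc (-(n + 1 : ℤ)) (n + 1) with hs
  set p : ℤ → Prop := fun k => (4 * (k * (k + 1))).natAbs = n ∧ (0 : ℤ) = L with hp
  have e1 : (s.filter fun k => p k ∧ 0 ≤ k).card = (s.filter fun k => p k ∧ ¬ 0 ≤ k).card := by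
    refine Finset.card_bij' (fun k _ => -1 - k) (fun k _ => -1 - k) ?_ ?_ (by simp) (by simp)
    all_goals
      intro k hk
      simp only [hs, hp, Finset.mem_filter, Finset.mem_Icc] at hk ⊢
      have e : 4 * ((-1 - k) * (-1 - k + 1)) = 4 * (k * (k + 1)) := by ring
      rw [e]
      have := abs_le_odd k
      rw [hk.2.1.1] at this
      refine ⟨?_, hk.2.1, by omega⟩
      have h3 := le_abs_self (4 * (k * (k + 1)))
      rw [Int.abs_eq_natAbs, hk.2.1.1] at h3
      constructor <;> nlinarith [hk.2.2]
  have e2 : (s.filter p).card = (s.filter fun k => p k ∧ 0 ≤ k).card +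
      (s.filter fun k => p k ∧ ¬ 0 ≤ k).card := by
    rw [← Finset.card_filter_add_card_filter_not (s := s.filter p) (fun k => 0 ≤ k),
      Finset.filter_filter, Finset.filter_filter]
  have e3 : (s.filter fun k => (4 * (k * (k + 1))).natAbs = n ∧ ((0 : ℕ) : ℤ) * (2 * k + 1) = L) =
      s.filter p := by
    simp [hp]
  rw [e3, e2, ← e1]
  push_cast; ring

lemma hasZ_St : HasZ (PowerSeries.X * St) (fun τ z => th2 0 τ z / 2) := by
  refine HasZ.half ?_
  rw [mul_left_comm, two_mul_St]
  exact hasZ_S2 0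

lemma two_dvd_S4_sub_S3 (v : ℕ) : 2 ∣ S4 v - S3 v := by
  refine ⟨thetaSer (fun k => (2 * k).natAbs ^ 2) (fun k => 2 * k * v)
    (fun k => ((k.negOnePow : ℤ) - 1) / 2), cf_ext fun n L => ?_⟩
  have h2 : (2 : LaurentSeries₂ ℤ) = cst 2 := by simp
  rw [h2, cf_cst_mul, cf_sub, S3, S4, cf_thetaSer, cf_thetaSer, cf_thetaSer, Finset.mul_sum,
    ← Finset.sum_sub_distrib]
  refine Finset.sum_congr rfl fun k _ => ?_
  rcases Int.even_or_odd k with h | h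
  · simp [Int.negOnePow_even k h]
  · simp [Int.negOnePow_odd k h]

section constantCoeff
open LaurentPolynomial

lemma icc_one : Finset.Icc (-((0 : ℕ) + 1 : ℤ)) ((0 : ℕ) + 1) = {-1, 0, 1} := by rfl

lemma constantCoeff_S3 (v : ℕ) : PowerSeries.constantCoeff (S3 v) = 1 := by
  rw [← PowerSeries.coeff_zero_eq_constantCoeff_apply, S3, thetaSer, PowerSeries.coeff_mk, icc_one]
  simp [Finset.filter_insert, Finset.filter_singleton]
lemma constantCoeff_S4 (v : ℕ) : PowerSeries.constantCoeff (S4 v) = 1 := by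
  rw [← PowerSeries.coeff_zero_eq_constantCoeff_apply, S4, thetaSer, PowerSeries.coeff_mk, icc_one]
  simp [Finset.filter_insert, Finset.filter_singleton]
lemma constantCoeff_S2 (v : ℕ) : PowerSeries.constantCoeff (S2 v) = T v + T (-v) := by
  rw [← PowerSeries.coeff_zero_eq_constantCoeff_apply, S2, thetaSer, PowerSeries.coeff_mk, icc_one]
  simp [Finset.filter_insert, Finset.filter_singleton, add_comm]
lemma constantCoeff_S1 : PowerSeries.constantCoeff S1 = T 1 - T (-1) := by
  rw [← PowerSeries.coeff_zero_eq_constantCoeff_apply, S1, thetaSer, PowerSeries.coeff_mk, icc_one]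
  simp [Finset.filter_insert, Finset.filter_singleton]
  ring
lemma constantCoeff_St : PowerSeries.constantCoeff St = 1 := by
  rw [← PowerSeries.coeff_zero_eq_constantCoeff_apply, St, thetaSer, PowerSeries.coeff_mk, icc_one]
  simp [Finset.filter_insert, Finset.filter_singleton]

end constantCoeff

/-! ### Integral Jacobi forms -/

lemma e2_eq_one_iff {a : ℂ} : e2 a = 1 ↔ ∃ n : ℤ, a = n := by
  rw [e2, Complex.exp_eq_one_iff]
  refine exists_congr fun n => ?_
  rw [mul_comm, mul_left_inj' Complex.two_pi_I_ne_zero]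

lemma fourier_unique {a b : ℕ × ℤ → ℂ} {g : ℂ → ℂ → ℂ}
    (ha : ∀ τ z : ℂ, 0 < τ.im → HasSum (fun p => a p * e2 ((p.1 : ℤ) * τ + p.2 * z)) (g τ z))
    (hb : ∀ τ z : ℂ, 0 < τ.im → HasSum (fun p => b p * e2 ((p.1 : ℤ) * τ + p.2 * z)) (g τ z))
    (p : ℕ × ℤ) : a p = b p := by
  have := tsum_fourier_eq ha hb p.1 p.2
  have h (c : ℕ × ℤ → ℂ) :
      ∑' q : ℕ × ℤ, (if ((q.1 : ℤ) = p.1 ∧ q.2 = p.2) then c q else 0) = c p := by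
    rw [tsum_eq_single p, if_pos ⟨rfl, rfl⟩]
    rintro q hq
    rw [if_neg]
    rintro ⟨h1, h2⟩
    exact hq (Prod.ext (by exact_mod_cast h1) h2)
  rwa [h, h] at this

/-- A double series in `e2 (τ / 8)` and `e2 (z / 2)` representing a function of period one in both
variables is a double series in `e2 τ` and `e2 z`. -/
lemma HasZ.exists_contraction {n : ℕ} {H : LaurentSeries₂ ℤ} {f : ℂ → ℂ → ℂ}
    (hf : HasZ (PowerSeries.X ^ (8 * n) * H) f)
    (hT : ∀ τ z : ℂ, 0 < τ.im → f (τ + 1) z = f τ z)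
    (hP : ∀ τ z : ℂ, 0 < τ.im → f τ (z + 1) = f τ z) :
    ∃ G : LaurentSeries₂ ℤ, (∀ τ z : ℂ, 0 < τ.im →
      Ev (toC (PowerSeries.X ^ n * G)) (e2 τ) (e2 z) (f τ z)) ∧
      ∀ l, (PowerSeries.constantCoeff G).coeff l = (PowerSeries.constantCoeff H).coeff (2 * l) := by
  set F := toC (PowerSeries.X ^ (8 * n) * H) with hF
  have im8 {τ : ℂ} (hτ : 0 < τ.im) : 0 < (8 * τ).im := by simpa using hτ
  have im81 {τ : ℂ} (hτ : 0 < τ.im) : 0 < (8 * τ + 1).im := by simpa using hτ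
  have ex (τ z : ℂ) (hτ : 0 < τ.im) :
      HasSum (fun p : ℕ × ℤ => cf F p.1 p.2 * e2 ((p.1 : ℤ) * τ + p.2 * z)) (f (8 * τ) (2 * z)) := by
    refine hasSum_of_eq (hf _ (2 * z) (im8 hτ)) fun p => ?_
    rw [← e2_lin]; congr 5 <;> ring
  have v1 (N : ℕ) (L : ℤ) (h : ¬ 8 ∣ N) : cf F N L = 0 := by
    have := fourier_unique (g := fun τ z => f (8 * τ) (2 * z)) ex
      (b := fun p => cf F p.1 p.2 * e2 (p.1 / 8)) (fun τ z hτ => by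
        rw [← hT _ _ (im8 hτ)]
        refine hasSum_of_eq (hf _ (2 * z) (im81 hτ)) fun p => ?_
        rw [e2_lin, mul_assoc, ← e2_add]; congr 2; push_cast; ring) (N, L)
    by_contra h0
    have h1 : e2 (N / 8) = 1 := mul_left_cancel₀ h0 (by rw [mul_one]; exact this.symm)
    obtain ⟨k, hk⟩ := e2_eq_one_iff.1 h1
    have h2 : (N : ℂ) = 8 * k := by linear_combination 8 * hk
    have h3 : (N : ℤ) = 8 * k := by exact_mod_cast h2
    omega
  have v2 (N : ℕ) (L : ℤ) (h : ¬ 2 ∣ L) : cf F N L = 0 := by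
    have := fourier_unique (g := fun τ z => f (8 * τ) (2 * z)) ex
      (b := fun p => cf F p.1 p.2 * e2 (p.2 / 2)) (fun τ z hτ => by
        rw [← hP _ _ (im8 hτ)]
        refine hasSum_of_eq (hf _ (2 * z + 1) (im8 hτ)) fun p => ?_
        rw [e2_lin, mul_assoc, ← e2_add]; congr 2; push_cast; ring) (N, L)
    by_contra h0
    have h1 : e2 (L / 2) = 1 := mul_left_cancel₀ h0 (by rw [mul_one]; exact this.symm)
    obtain ⟨k, hk⟩ := e2_eq_one_iff.1 h1
    have h2 : (L : ℂ) = 2 * k := by linear_combination 2 * hk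
    have h3 : (L : ℤ) = 2 * k := by exact_mod_cast h2
    omega
  have hinj : Function.Injective fun l : ℤ => 2 * l := fun a b h => by simpa using h
  let G : LaurentSeries₂ ℤ := PowerSeries.mk fun i => AddMonoidAlgebra.ofCoeff
    (Finsupp.comapDomain (fun l => 2 * l) (PowerSeries.coeff (8 * i) H).coeff hinj.injOn)
  have hG (i : ℕ) (l : ℤ) : cf G i l = cf H (8 * i) (2 * l) := by
    simp [G, cf, PowerSeries.coeff_mk]
  refine ⟨G, fun τ z hτ => ?_, fun l => ?_⟩
  swap
  · rw [← PowerSeries.coeff_zero_eq_constantCoeff_apply, ← PowerSeries.coeff_zero_eq_constantCoeff_apply]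
    exact hG 0 l
  have hi : Function.Injective fun p : ℕ × ℤ => (8 * p.1, 2 * p.2) := by
    rintro ⟨a, b⟩ ⟨c, d⟩ h
    simp only [Prod.mk.injEq] at h
    ext <;> simp only <;> omega
  refine hasSum_of_eq ((hi.hasSum_iff fun p hp => ?_).2 (hf τ z hτ)) fun p => ?_
  · by_cases h1 : 8 ∣ p.1
    · by_cases h2 : 2 ∣ p.2
      · obtain ⟨a, ha⟩ := h1
        obtain ⟨b, hb⟩ := h2
        exact absurd ⟨(a, b), by ext <;> simp [ha, hb]⟩ hp
      · rw [v2 _ _ h2, zero_mul]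
    · rw [v1 _ _ h1, zero_mul]
  · simp only [Function.comp]
    rw [cf_toC, cf_toC, cf_X_pow_mul, cf_X_pow_mul]
    congr 1
    · congr 1
      by_cases h : n ≤ p.1
      · rw [if_pos h, if_pos (by omega), hG]
        congr 1; omega
      · rw [if_neg h, if_neg (by omega)]
    · rw [e2_lin, e2_lin]; congr 1; push_cast; ring

/-- There is a Jacobi form of weight `w` and index `m` with integral Fourier expansion of the shape
`sig Q * q ^ n + O(q ^ (n + 1))`. -/
def IJ (w : ℤ) (m n : ℕ) (Q : Polynomial ℤ) : Prop :=
  Q.natDegree ≤ m ∧ ∃ (f : ℂ → ℂ → ℂ) (G : LaurentSeries₂ ℤ),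
    IsJ w m f (toC (PowerSeries.X ^ n * G)) ∧ PowerSeries.constantCoeff G = sig Q

namespace IJ
variable {w w' : ℤ} {m m' n n' : ℕ} {Q Q' : Polynomial ℤ}

lemma cast (h : IJ w m n Q) (hw : w = w') (hm : m = m') (hn : n = n') (hQ : Q = Q') :
    IJ w' m' n' Q' := by subst hw hm hn hQ; exact h

lemma mul (h : IJ w m n Q) (h' : IJ w' m' n' Q') : IJ (w + w') (m + m') (n + n') (Q * Q') := by
  obtain ⟨d, f, G, hf, hG⟩ := h
  obtain ⟨d', f', G', hf', hG'⟩ := h'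
  refine ⟨Polynomial.natDegree_mul_le.trans (add_le_add d d'), fun τ z => f τ z * f' τ z, G * G', ?_, by
    rw [map_mul, map_mul, hG, hG']⟩
  have e : (PowerSeries.X : LaurentSeries₂ ℤ) ^ (n + n') * (G * G') =
      PowerSeries.X ^ n * G * (PowerSeries.X ^ n' * G') := by rw [pow_add]; ring
  rw [e, map_mul]
  exact hf.mul hf'

lemma add (h : IJ w m n Q) (h' : IJ w m n Q') : IJ w m n (Q + Q') := by
  obtain ⟨d, f, G, hf, hG⟩ := h
  obtain ⟨d', f', G', hf', hG'⟩ := h'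
  refine ⟨Polynomial.natDegree_add_le_of_degree_le d d', fun τ z => f τ z + f' τ z, G + G', ?_, by
    rw [map_add, map_add, hG, hG']⟩
  rw [mul_add, map_add]
  exact hf.add hf'

lemma zsmul (a : ℤ) (h : IJ w m n Q) : IJ w m n (Polynomial.C a * Q) := by
  obtain ⟨d, f, G, hf, hG⟩ := h
  refine ⟨(Polynomial.natDegree_C_mul_le _ _).trans d, fun τ z => a * f τ z, cst a * G, ?_, by
    rw [map_mul, map_mul, hG, sig_C]; simp [cst]⟩
  rw [mul_left_comm, map_mul, toC_cst]
  exact hf.smul _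

lemma zero : IJ w m n 0 := ⟨by simp, fun _ _ => 0, 0, by simpa using IsJ.zero, by simp⟩

lemma one : IJ 0 0 0 1 := ⟨by simp, fun _ _ => 1, 1, by simpa using IsJ.one, by simp⟩

lemma pow (h : IJ w m n Q) (j : ℕ) : IJ (j * w) (j * m) (j * n) (Q ^ j) := by
  induction j with
  | zero => exact one.cast (by simp) (by simp) (by simp) (by simp)
  | succ j ih => exact (ih.mul h).cast (by push_cast; ring) (by ring) (by ring) (by rw [pow_succ])

lemma sum {ι : Type*} (s : Finset ι) {Q : ι → Polynomial ℤ} (h : ∀ i ∈ s, IJ w m n (Q i)) :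
    IJ w m n (∑ i ∈ s, Q i) := by
  classical
  induction s using Finset.induction_on with
  | empty => simpa using zero
  | insert i s hi ih =>
    rw [Finset.sum_insert hi]
    exact (h i (by simp)).add (ih fun j hj => h j (by simp [hj]))

end IJ

lemma invFactor_pow_eight (τ : ℂ) : invFactor τ ^ 8 = τ ^ 4 := by
  rw [show 8 = 2 * 4 from rfl, pow_mul, invFactor_sq, mul_pow, neg_pow, I_pow_four]; norm_num
lemma invFactor_pow_twelve (τ : ℂ) : invFactor τ ^ 12 = -τ ^ 6 := by
  rw [show 12 = 2 * 6 from rfl, pow_mul, invFactor_sq, mul_pow, neg_pow, show 6 = 4 + 2 from rfl,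
    pow_add I, I_pow_four, I_sq]; norm_num
lemma e2_eighth_pow_four : e2 (1 / 8) ^ 4 = -1 := by
  rw [← e2_nat_mul, ← e2_half]; congr 1; norm_num
lemma e2_eighth_pow_eight : e2 (1 / 8) ^ 8 = 1 := by
  rw [show 8 = 4 * 2 from rfl, pow_mul, e2_eighth_pow_four]; norm_num

/-- Criterion for a polynomial in theta functions to be an integral Jacobi form. -/
lemma IJ.of_hasZ {w m n : ℕ} {H : LaurentSeries₂ ℤ} {f : ℂ → ℂ → ℂ} {Q : Polynomial ℤ}
    (hf : HasZ (PowerSeries.X ^ (8 * n) * H) f)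
    (hT : ∀ τ z : ℂ, f (τ + 1) z = f τ z) (hP : ∀ τ z : ℂ, f τ (z + 1) = f τ z)
    (hinv : ∀ τ z : ℂ, τ ≠ 0 → f (-1 / τ) (z / τ) = τ ^ w * invExp τ z ^ (2 * m) * f τ z)
    (hell : ∀ τ z : ℂ, f τ (z + τ) = ellFactor τ z ^ (2 * m) * f τ z)
    (hpar : ∀ τ z : ℂ, f τ (-z) = f τ z)
    (hQ : Q.natDegree ≤ m)
    (h0 : ∀ l, (PowerSeries.constantCoeff H).coeff (2 * l) = (sig Q).coeff l) : IJ w m n Q := by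
  obtain ⟨G, hG, hG0⟩ := hf.exists_contraction (fun τ z _ => hT τ z) (fun τ z _ => hP τ z)
  refine ⟨hQ, f, G, ⟨hG, fun τ z hτ => ?_, fun τ z _ => ?_, fun τ z _ => hpar τ z⟩, ?_⟩
  · have h := ne_zero_of_im_pos hτ
    rw [hinv τ z h, zpow_natCast, invExp, ← e2_nat_mul]
    congr 3; push_cast; field_simp
  · rw [hell τ z, ellFactor, ← e2_nat_mul]
    congr 2; push_cast; ring
  · ext l; rw [hG0, h0]

/-! ### Some integral Jacobi forms -/

open LaurentPolynomial in
lemma coeff_two_mul_X_add (a l : ℤ) : (T 2 + C a + T (-2) : LaurentPolynomial ℤ).coeff (2 * l) =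
    (sig (Polynomial.X + Polynomial.C (a + 2))).coeff l := by
  have h1 : (2 = 2 * l) ↔ (1 = l) := by omega
  have h2 : (-2 = 2 * l) ↔ (-1 = l) := by omega
  have h3 : (2 * l = 0) ↔ (l = 0) := by omega
  rw [map_add, sig_X, sig_C, symS]
  rw [map_add]
  simp only [AddMonoidAlgebra.coeff_add, AddMonoidAlgebra.coeff_sub, Finsupp.add_apply, Finsupp.sub_apply,
    T_apply, C_apply, h1, h2, h3]
  ring

lemma coeff_two_mul_one (l : ℤ) : (1 : LaurentPolynomial ℤ).coeff (2 * l) = (sig 1).coeff l := by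
  have h3 : (2 * l = 0) ↔ (l = 0) := by omega
  rw [map_one, ← map_one LaurentPolynomial.C, LaurentPolynomial.C_apply, LaurentPolynomial.C_apply]
  simp only [h3]

lemma natDegree_X_add_le (a : ℤ) {m : ℕ} (hm : 1 ≤ m) :
    (Polynomial.X + Polynomial.C a).natDegree ≤ m := by
  rwa [Polynomial.natDegree_X_add_C]

/-- Reduction modulo two. -/
def modTwo : LaurentSeries₂ ℤ →+* LaurentSeries₂ ℤ ⧸ Ideal.span {(2 : LaurentSeries₂ ℤ)} :=
  Ideal.Quotient.mk _

lemma two_dvd_of_modTwo {F : LaurentSeries₂ ℤ} (h : modTwo F = 0) : ∃ K, F = 2 * K :=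
  Ideal.mem_span_singleton.1 (Ideal.Quotient.eq_zero_iff_mem.1 h)

lemma modTwo_of_dvd {F : LaurentSeries₂ ℤ} (h : 2 ∣ F) : modTwo F = 0 :=
  Ideal.Quotient.eq_zero_iff_mem.2 (Ideal.mem_span_singleton.2 h)

lemma modTwo_S4 (v : ℕ) : modTwo (S4 v) = modTwo (S3 v) := by
  rw [← sub_eq_zero, ← map_sub]
  exact modTwo_of_dvd (two_dvd_S4_sub_S3 v)

lemma modTwo_S2_zero : modTwo (S2 0) = 0 := by
  rw [← two_mul_St]
  exact modTwo_of_dvd ⟨_, rfl⟩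

lemma modTwo_two : (2 : LaurentSeries₂ ℤ ⧸ Ideal.span {(2 : LaurentSeries₂ ℤ)}) = 0 := by
  rw [← map_ofNat modTwo 2]
  exact modTwo_of_dvd (dvd_refl _)

lemma constantCoeff_eq_of_two_mul {K F : LaurentSeries₂ ℤ} {P : LaurentPolynomial ℤ} (h : F = 2 * K)
    (hF : PowerSeries.constantCoeff F = 2 * P) : PowerSeries.constantCoeff K = P := by
  rw [h, map_mul, map_ofNat] at hF
  ext l
  have := congrArg (fun Q : LaurentPolynomial ℤ => Q.coeff l) hF
  simp only [two_mul, AddMonoidAlgebra.coeff_add, Finsupp.add_apply] at this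
  omega

section forms
open LaurentPolynomial

/-- The discriminant. -/
lemma IJ_delta : IJ 12 0 1 1 := by
  refine IJ.of_hasZ (w := 12) (H := St ^ 8 * (S3 0 * S4 0) ^ 8)
    (f := fun τ z => (th2 0 τ z / 2) ^ 8 * (th3 0 τ z * th4 0 τ z) ^ 8) ?_ ?_ ?_ ?_ ?_ ?_ ?_ ?_
  · have : PowerSeries.X ^ (8 * 1) * (St ^ 8 * (S3 0 * S4 0) ^ 8) =
      (PowerSeries.X * St) ^ 8 * (S3 0 * S4 0) ^ 8 := by ring
    rw [this]
    exact (hasZ_St.pow 8).mul (((hasZ_S3 0).mul (hasZ_S4 0)).pow 8)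
  · intro τ z
    simp only [th2_T, th3_T, th4_T]
    linear_combination (th2 0 τ z / 2) ^ 8 * (th3 0 τ z * th4 0 τ z) ^ 8 * e2_eighth_pow_eight
  · intro τ z
    simp only [th2_add_one, th3_add_one, th4_add_one]
    ring
  · intro τ z h
    have hs := invFactor_pow_twelve τ
    simp only [th2_inv _ _ h, th3_inv _ _ h, th4_inv _ _ h]
    linear_combination (th2 0 τ z / 2) ^ 8 * (th3 0 τ z * th4 0 τ z) ^ 8 *
      (invFactor τ ^ 12 - τ ^ 6) * hs
  · intro τ z
    simp only [th2_add, th3_add, th4_add]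
    ring
  · intro τ z
    simp only [th2_neg, th3_neg, th4_neg]
  · simp
  · intro l
    simp only [map_mul, map_pow, constantCoeff_St, constantCoeff_S3, constantCoeff_S4, one_pow, mul_one]
    exact coeff_two_mul_one l

/-- The cusp form of weight ten and index one. -/
lemma IJ_phi10 : IJ 10 1 1 Polynomial.X := by
  refine IJ.of_hasZ (w := 10) (H := S1 ^ 2 * St ^ 6 * (S3 0 * S4 0) ^ 6)
    (f := fun τ z => th1 τ z ^ 2 * (th2 0 τ z / 2) ^ 6 * (th3 0 τ z * th4 0 τ z) ^ 6) ?_ ?_ ?_ ?_ ?_ ?_ ?_ ?_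
  · have : PowerSeries.X ^ (8 * 1) * (S1 ^ 2 * St ^ 6 * (S3 0 * S4 0) ^ 6) =
      (PowerSeries.X * S1) ^ 2 * (PowerSeries.X * St) ^ 6 * (S3 0 * S4 0) ^ 6 := by ring
    rw [this]
    exact ((hasZ_S1.pow 2).mul (hasZ_St.pow 6)).mul (((hasZ_S3 0).mul (hasZ_S4 0)).pow 6)
  · intro τ z
    simp only [th1_T, th2_T, th3_T, th4_T]
    linear_combination th1 τ z ^ 2 * (th2 0 τ z / 2) ^ 6 * (th3 0 τ z * th4 0 τ z) ^ 6 * e2_eighth_pow_eight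
  · intro τ z
    simp only [th1_add_one, th2_add_one, th3_add_one, th4_add_one]
    ring
  · intro τ z h
    have hs : invFactor τ ^ 20 = -τ ^ 10 := by
      linear_combination invFactor τ ^ 8 * invFactor_pow_twelve τ - τ ^ 6 * invFactor_pow_eight τ
    simp only [th1_inv _ h, th2_inv _ _ h, th3_inv _ _ h, th4_inv _ _ h]
    linear_combination th1 τ z ^ 2 * (th2 0 τ z / 2) ^ 6 * (th3 0 τ z * th4 0 τ z) ^ 6 *
      invExp τ z ^ 2 * (invFactor τ ^ 20 * I_sq - hs)
  · intro τ z
    simp only [th1_add, th2_add, th3_add, th4_add]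
    ring
  · intro τ z
    simp only [th1_neg, th2_neg, th3_neg, th4_neg]
    ring
  · simp
  · intro l
    have hT : (T 1 - T (-1) : LaurentPolynomial ℤ) ^ 2 = T 2 + C (-2) + T (-2) := by
      have h1 : (T 1 * T 1 : LaurentPolynomial ℤ) = T 2 := by rw [← T_add]; rfl
      have h2 : (T (-1) * T (-1) : LaurentPolynomial ℤ) = T (-2) := by rw [← T_add]; rfl
      have h3 : (T 1 * T (-1) : LaurentPolynomial ℤ) = 1 := by rw [← T_add]; rfl
      rw [map_neg, map_ofNat]
      linear_combination h1 + h2 - 2 * h3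
    simp only [map_mul, map_pow, constantCoeff_St, constantCoeff_S3, constantCoeff_S4, constantCoeff_S1,
      one_pow, mul_one, hT]
    simpa using coeff_two_mul_X_add (-2) l

lemma sq_T_add : (T (1 : ℕ) + T (-(1 : ℕ)) : LaurentPolynomial ℤ) ^ 2 = T 2 + C 2 + T (-2) := by
  have h1 : (T 1 * T 1 : LaurentPolynomial ℤ) = T 2 := by rw [← T_add]; rfl
  have h2 : (T (-1) * T (-1) : LaurentPolynomial ℤ) = T (-2) := by rw [← T_add]; rfl
  have h3 : (T 1 * T (-1) : LaurentPolynomial ℤ) = 1 := by rw [← T_add]; rfl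
  rw [map_ofNat, Nat.cast_one]
  linear_combination h1 + h2 + 2 * h3

lemma invFactor_pow_twenty_four (τ : ℂ) : invFactor τ ^ 24 = τ ^ 12 := by
  linear_combination (invFactor τ ^ 12 - τ ^ 6) * invFactor_pow_twelve τ

lemma IJ_D1 : IJ 12 1 1 (Polynomial.X + Polynomial.C 12) := by
  refine IJ.of_hasZ (w := 12) (H := S2 1 ^ 2 * St ^ 6 * (S3 0 * S4 0) ^ 8 +
      cst 4 * (St ^ 8 * (S3 1 ^ 2 * S3 0 ^ 6 * S4 0 ^ 8 + S4 1 ^ 2 * S4 0 ^ 6 * S3 0 ^ 8)))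
    (f := fun τ z => th2 1 τ z ^ 2 * (th2 0 τ z / 2) ^ 6 * (th3 0 τ z * th4 0 τ z) ^ 8 +
      (4 : ℤ) * ((th2 0 τ z / 2) ^ 8 * (th3 1 τ z ^ 2 * th3 0 τ z ^ 6 * th4 0 τ z ^ 8 +
        th4 1 τ z ^ 2 * th4 0 τ z ^ 6 * th3 0 τ z ^ 8)))
    ?_ ?_ ?_ ?_ ?_ ?_ (natDegree_X_add_le _ le_rfl) ?_
  · have : PowerSeries.X ^ (8 * 1) * (S2 1 ^ 2 * St ^ 6 * (S3 0 * S4 0) ^ 8 +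
        cst 4 * (St ^ 8 * (S3 1 ^ 2 * S3 0 ^ 6 * S4 0 ^ 8 + S4 1 ^ 2 * S4 0 ^ 6 * S3 0 ^ 8))) =
      (PowerSeries.X * S2 1) ^ 2 * (PowerSeries.X * St) ^ 6 * (S3 0 * S4 0) ^ 8 +
        cst 4 * ((PowerSeries.X * St) ^ 8 *
          (S3 1 ^ 2 * S3 0 ^ 6 * S4 0 ^ 8 + S4 1 ^ 2 * S4 0 ^ 6 * S3 0 ^ 8)) := by ring
    rw [this]
    exact ((((hasZ_S2 1).pow 2).mul (hasZ_St.pow 6)).mul (((hasZ_S3 0).mul (hasZ_S4 0)).pow 8)).add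
      (((hasZ_St.pow 8).mul (((((hasZ_S3 1).pow 2).mul ((hasZ_S3 0).pow 6)).mul ((hasZ_S4 0).pow 8)).add
        ((((hasZ_S4 1).pow 2).mul ((hasZ_S4 0).pow 6)).mul ((hasZ_S3 0).pow 8)))).zmul 4)
  · intro τ z
    simp only [th2_T, th3_T, th4_T]
    linear_combination (th2 1 τ z ^ 2 * (th2 0 τ z / 2) ^ 6 * (th3 0 τ z * th4 0 τ z) ^ 8 +
      (4 : ℤ) * ((th2 0 τ z / 2) ^ 8 * (th3 1 τ z ^ 2 * th3 0 τ z ^ 6 * th4 0 τ z ^ 8 +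
        th4 1 τ z ^ 2 * th4 0 τ z ^ 6 * th3 0 τ z ^ 8))) * e2_eighth_pow_eight
  · intro τ z
    simp only [th2_add_one, th3_add_one, th4_add_one]
    ring
  · intro τ z h
    have hs := invFactor_pow_twenty_four τ
    simp only [th2_inv _ _ h, th3_inv _ _ h, th4_inv _ _ h]
    linear_combination (th2 1 τ z ^ 2 * (th2 0 τ z / 2) ^ 6 * (th3 0 τ z * th4 0 τ z) ^ 8 +
      (4 : ℤ) * ((th2 0 τ z / 2) ^ 8 * (th3 1 τ z ^ 2 * th3 0 τ z ^ 6 * th4 0 τ z ^ 8 +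
        th4 1 τ z ^ 2 * th4 0 τ z ^ 6 * th3 0 τ z ^ 8))) * invExp τ z ^ 2 * hs
  · intro τ z
    simp only [th2_add, th3_add, th4_add]
    ring
  · intro τ z
    simp only [th2_neg, th3_neg, th4_neg]
  · intro l
    refine Eq.trans ?_ (coeff_two_mul_X_add 10 l)
    congr 2
    simp only [map_mul, map_add, map_pow, constantCoeff_St, constantCoeff_S3, constantCoeff_S4,
      constantCoeff_S2, one_pow, mul_one, sq_T_add, map_ofNat]
    ring

lemma IJ_D2 : IJ 12 2 1 (Polynomial.X + Polynomial.C 6) := by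
  refine IJ.of_hasZ (w := 12) (H := S2 2 * St ^ 7 * (S3 0 * S4 0) ^ 8 +
      cst 2 * (St ^ 8 * (S3 2 * S3 0 ^ 7 * S4 0 ^ 8 + S4 2 * S4 0 ^ 7 * S3 0 ^ 8)))
    (f := fun τ z => th2 2 τ z * (th2 0 τ z / 2) ^ 7 * (th3 0 τ z * th4 0 τ z) ^ 8 +
      (2 : ℤ) * ((th2 0 τ z / 2) ^ 8 * (th3 2 τ z * th3 0 τ z ^ 7 * th4 0 τ z ^ 8 +
        th4 2 τ z * th4 0 τ z ^ 7 * th3 0 τ z ^ 8)))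
    ?_ ?_ ?_ ?_ ?_ ?_ (natDegree_X_add_le _ (by norm_num)) ?_
  · have : PowerSeries.X ^ (8 * 1) * (S2 2 * St ^ 7 * (S3 0 * S4 0) ^ 8 +
        cst 2 * (St ^ 8 * (S3 2 * S3 0 ^ 7 * S4 0 ^ 8 + S4 2 * S4 0 ^ 7 * S3 0 ^ 8))) =
      (PowerSeries.X * S2 2) * (PowerSeries.X * St) ^ 7 * (S3 0 * S4 0) ^ 8 +
        cst 2 * ((PowerSeries.X * St) ^ 8 * (S3 2 * S3 0 ^ 7 * S4 0 ^ 8 + S4 2 * S4 0 ^ 7 * S3 0 ^ 8)) := by ring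
    rw [this]
    exact (((hasZ_S2 2).mul (hasZ_St.pow 7)).mul (((hasZ_S3 0).mul (hasZ_S4 0)).pow 8)).add
      (((hasZ_St.pow 8).mul ((((hasZ_S3 2).mul ((hasZ_S3 0).pow 7)).mul ((hasZ_S4 0).pow 8)).add
        (((hasZ_S4 2).mul ((hasZ_S4 0).pow 7)).mul ((hasZ_S3 0).pow 8)))).zmul 2)
  · intro τ z
    simp only [th2_T, th3_T, th4_T]
    linear_combination (th2 2 τ z * (th2 0 τ z / 2) ^ 7 * (th3 0 τ z * th4 0 τ z) ^ 8 +
      (2 : ℤ) * ((th2 0 τ z / 2) ^ 8 * (th3 2 τ z * th3 0 τ z ^ 7 * th4 0 τ z ^ 8 +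
        th4 2 τ z * th4 0 τ z ^ 7 * th3 0 τ z ^ 8))) *
      e2_eighth_pow_eight
  · intro τ z
    simp only [th2_add_one, th3_add_one, th4_add_one]
    ring
  · intro τ z h
    have hs := invFactor_pow_twenty_four τ
    simp only [th2_inv _ _ h, th3_inv _ _ h, th4_inv _ _ h]
    linear_combination (th2 2 τ z * (th2 0 τ z / 2) ^ 7 * (th3 0 τ z * th4 0 τ z) ^ 8 +
      (2 : ℤ) * ((th2 0 τ z / 2) ^ 8 * (th3 2 τ z * th3 0 τ z ^ 7 * th4 0 τ z ^ 8 +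
        th4 2 τ z * th4 0 τ z ^ 7 * th3 0 τ z ^ 8))) *
      invExp τ z ^ 4 * hs
  · intro τ z
    simp only [th2_add, th3_add, th4_add]
    ring
  · intro τ z
    simp only [th2_neg, th3_neg, th4_neg]
  · intro l
    refine Eq.trans ?_ (coeff_two_mul_X_add 4 l)
    congr 2
    simp only [map_mul, map_add, map_pow, constantCoeff_St, constantCoeff_S3, constantCoeff_S4,
      constantCoeff_S2, one_pow, mul_one, one_mul, map_ofNat]
    push_cast
    ring

lemma IJ_D3 : IJ 12 3 1 (Polynomial.X + Polynomial.C 4) := by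
  refine IJ.of_hasZ (w := 12) (H := S2 1 ^ 2 * S3 1 ^ 2 * S4 1 ^ 2 * St ^ 6 * S3 0 ^ 6 * S4 0 ^ 6)
    (f := fun τ z => th2 1 τ z ^ 2 * th3 1 τ z ^ 2 * th4 1 τ z ^ 2 * (th2 0 τ z / 2) ^ 6 *
      th3 0 τ z ^ 6 * th4 0 τ z ^ 6)
    ?_ ?_ ?_ ?_ ?_ ?_ (natDegree_X_add_le _ (by norm_num)) ?_
  · have : PowerSeries.X ^ (8 * 1) * (S2 1 ^ 2 * S3 1 ^ 2 * S4 1 ^ 2 * St ^ 6 * S3 0 ^ 6 * S4 0 ^ 6) =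
      (PowerSeries.X * S2 1) ^ 2 * S3 1 ^ 2 * S4 1 ^ 2 * (PowerSeries.X * St) ^ 6 * S3 0 ^ 6 * S4 0 ^ 6 := by
      ring
    rw [this]
    exact ((((((hasZ_S2 1).pow 2).mul ((hasZ_S3 1).pow 2)).mul ((hasZ_S4 1).pow 2)).mul
      (hasZ_St.pow 6)).mul ((hasZ_S3 0).pow 6)).mul ((hasZ_S4 0).pow 6)
  · intro τ z
    simp only [th2_T, th3_T, th4_T]
    linear_combination (th2 1 τ z ^ 2 * th3 1 τ z ^ 2 * th4 1 τ z ^ 2 * (th2 0 τ z / 2) ^ 6 *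
      th3 0 τ z ^ 6 * th4 0 τ z ^ 6) *
      e2_eighth_pow_eight
  · intro τ z
    simp only [th2_add_one, th3_add_one, th4_add_one]
    ring
  · intro τ z h
    have hs := invFactor_pow_twenty_four τ
    simp only [th2_inv _ _ h, th3_inv _ _ h, th4_inv _ _ h]
    linear_combination (th2 1 τ z ^ 2 * th3 1 τ z ^ 2 * th4 1 τ z ^ 2 * (th2 0 τ z / 2) ^ 6 *
      th3 0 τ z ^ 6 * th4 0 τ z ^ 6) *
      invExp τ z ^ 6 * hs
  · intro τ z
    simp only [th2_add, th3_add, th4_add]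
    ring
  · intro τ z
    simp only [th2_neg, th3_neg, th4_neg]
  · intro l
    refine Eq.trans ?_ (coeff_two_mul_X_add 2 l)
    congr 2
    simp only [map_mul, map_pow, constantCoeff_St, constantCoeff_S3, constantCoeff_S4,
      constantCoeff_S2, one_pow, mul_one, sq_T_add, map_ofNat]

lemma IJ_D4 : IJ 12 4 1 (Polynomial.X + Polynomial.C 3) := by
  obtain ⟨K, hK⟩ := two_dvd_of_modTwo (F := (S3 2 * S3 0 ^ 7 * S4 0 ^ 8 + S4 2 * S4 0 ^ 7 * S3 0 ^ 8)) (by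
    simp only [map_add, map_mul, map_pow, modTwo_S4]
    linear_combination (modTwo (S3 2) * modTwo (S3 0) ^ 15) * modTwo_two)
  refine IJ.of_hasZ (w := 12) (H := St ^ 8 * S3 2 * S4 2 * S3 0 ^ 7 * S4 0 ^ 7 + S2 2 * St ^ 7 * K)
    (f := fun τ z => (th2 0 τ z / 2) ^ 8 * th3 2 τ z * th4 2 τ z * th3 0 τ z ^ 7 * th4 0 τ z ^ 7 +
      th2 2 τ z * (th2 0 τ z / 2) ^ 7 * ((th3 2 τ z * th3 0 τ z ^ 7 * th4 0 τ z ^ 8 +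
        th4 2 τ z * th4 0 τ z ^ 7 * th3 0 τ z ^ 8) / 2))
    ?_ ?_ ?_ ?_ ?_ ?_ (natDegree_X_add_le _ (by norm_num)) ?_
  · have : PowerSeries.X ^ (8 * 1) * (St ^ 8 * S3 2 * S4 2 * S3 0 ^ 7 * S4 0 ^ 7 + S2 2 * St ^ 7 * K) =
      (PowerSeries.X * St) ^ 8 * S3 2 * S4 2 * S3 0 ^ 7 * S4 0 ^ 7 +
        (PowerSeries.X * S2 2) * (PowerSeries.X * St) ^ 7 * K := by ring
    rw [this]
    exact (((((hasZ_St.pow 8).mul (hasZ_S3 2)).mul (hasZ_S4 2)).mul ((hasZ_S3 0).pow 7)).mul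
      ((hasZ_S4 0).pow 7)).add (((hasZ_S2 2).mul (hasZ_St.pow 7)).mul (HasZ.half (by
        rw [← hK]
        exact ((((hasZ_S3 2).mul ((hasZ_S3 0).pow 7)).mul ((hasZ_S4 0).pow 8)).add
        (((hasZ_S4 2).mul ((hasZ_S4 0).pow 7)).mul ((hasZ_S3 0).pow 8))))))
  · intro τ z
    simp only [th2_T, th3_T, th4_T]
    linear_combination ((th2 0 τ z / 2) ^ 8 * th3 2 τ z * th4 2 τ z * th3 0 τ z ^ 7 * th4 0 τ z ^ 7 +
      th2 2 τ z * (th2 0 τ z / 2) ^ 7 * ((th3 2 τ z * th3 0 τ z ^ 7 * th4 0 τ z ^ 8 +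
        th4 2 τ z * th4 0 τ z ^ 7 * th3 0 τ z ^ 8) / 2)) *
      e2_eighth_pow_eight
  · intro τ z
    simp only [th2_add_one, th3_add_one, th4_add_one]
    ring
  · intro τ z h
    have hs := invFactor_pow_twenty_four τ
    simp only [th2_inv _ _ h, th3_inv _ _ h, th4_inv _ _ h]
    linear_combination ((th2 0 τ z / 2) ^ 8 * th3 2 τ z * th4 2 τ z * th3 0 τ z ^ 7 * th4 0 τ z ^ 7 +
      th2 2 τ z * (th2 0 τ z / 2) ^ 7 * ((th3 2 τ z * th3 0 τ z ^ 7 * th4 0 τ z ^ 8 +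
        th4 2 τ z * th4 0 τ z ^ 7 * th3 0 τ z ^ 8) / 2)) *
      invExp τ z ^ 8 * hs
  · intro τ z
    simp only [th2_add, th3_add, th4_add]
    ring
  · intro τ z
    simp only [th2_neg, th3_neg, th4_neg]
  · intro l
    refine Eq.trans ?_ (coeff_two_mul_X_add 1 l)
    congr 2
    have hK0 := constantCoeff_eq_of_two_mul (P := 1) hK (by
      simp only [map_mul, map_add, map_pow, constantCoeff_S3, constantCoeff_S4]
      norm_num)
    simp only [map_mul, map_add, map_pow, constantCoeff_St, constantCoeff_S3, constantCoeff_S4,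
      constantCoeff_S2, hK0, one_pow, mul_one, map_one]
    push_cast
    ring

lemma IJ_D6 : IJ 12 6 1 (Polynomial.X + Polynomial.C 2) := by
  refine IJ.of_hasZ (w := 12) (H := S2 2 * S3 2 * S4 2 * St ^ 7 * S3 0 ^ 7 * S4 0 ^ 7)
    (f := fun τ z => th2 2 τ z * th3 2 τ z * th4 2 τ z * (th2 0 τ z / 2) ^ 7 *
      th3 0 τ z ^ 7 * th4 0 τ z ^ 7)
    ?_ ?_ ?_ ?_ ?_ ?_ (natDegree_X_add_le _ (by norm_num)) ?_
  · have : PowerSeries.X ^ (8 * 1) * (S2 2 * S3 2 * S4 2 * St ^ 7 * S3 0 ^ 7 * S4 0 ^ 7) =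
      (PowerSeries.X * S2 2) * S3 2 * S4 2 * (PowerSeries.X * St) ^ 7 * S3 0 ^ 7 * S4 0 ^ 7 := by
      ring
    rw [this]
    exact (((((hasZ_S2 2).mul (hasZ_S3 2)).mul (hasZ_S4 2)).mul
      (hasZ_St.pow 7)).mul ((hasZ_S3 0).pow 7)).mul ((hasZ_S4 0).pow 7)
  · intro τ z
    simp only [th2_T, th3_T, th4_T]
    linear_combination (th2 2 τ z * th3 2 τ z * th4 2 τ z * (th2 0 τ z / 2) ^ 7 *
      th3 0 τ z ^ 7 * th4 0 τ z ^ 7) *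
      e2_eighth_pow_eight
  · intro τ z
    simp only [th2_add_one, th3_add_one, th4_add_one]
    ring
  · intro τ z h
    have hs := invFactor_pow_twenty_four τ
    simp only [th2_inv _ _ h, th3_inv _ _ h, th4_inv _ _ h]
    linear_combination (th2 2 τ z * th3 2 τ z * th4 2 τ z * (th2 0 τ z / 2) ^ 7 *
      th3 0 τ z ^ 7 * th4 0 τ z ^ 7) *
      invExp τ z ^ 12 * hs
  · intro τ z
    simp only [th2_add, th3_add, th4_add]
    ring
  · intro τ z
    simp only [th2_neg, th3_neg, th4_neg]
  · intro l
    refine Eq.trans ?_ (coeff_two_mul_X_add 0 l)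
    congr 2
    simp only [map_mul, map_pow, constantCoeff_St, constantCoeff_S3, constantCoeff_S4,
      constantCoeff_S2, one_pow, mul_one, map_zero]
    push_cast
    ring

section eisenstein
variable {M v₁ v₂ v₃ v₄ : ℕ}

lemma neg_one_pow_four_squares (hv : v₁ ^ 2 + v₂ ^ 2 + v₃ ^ 2 + v₄ ^ 2 = 2 * M) :
    ((-1) ^ v₁ * (-1) ^ v₂ * (-1) ^ v₃ * (-1) ^ v₄ : ℂ) = 1 := by
  rw [← pow_add, ← pow_add, ← pow_add]
  refine Even.neg_one_pow ?_
  have h : Even (v₁ ^ 2 + v₂ ^ 2 + v₃ ^ 2 + v₄ ^ 2) := ⟨M, by rw [hv]; ring⟩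
  simpa [Nat.even_add, Nat.even_pow] using h

lemma pow_four_squares (hv : v₁ ^ 2 + v₂ ^ 2 + v₃ ^ 2 + v₄ ^ 2 = 2 * M) (x : ℂ) :
    x ^ v₁ ^ 2 * x ^ v₂ ^ 2 * x ^ v₃ ^ 2 * x ^ v₄ ^ 2 = x ^ (2 * M) := by
  rw [← hv, pow_add, pow_add, pow_add]

lemma IJ_A4_aux (hv : v₁ ^ 2 + v₂ ^ 2 + v₃ ^ 2 + v₄ ^ 2 = 2 * M) : IJ 4 M 0 1 := by
  obtain ⟨K, hK⟩ := two_dvd_of_modTwo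
    (F := (PowerSeries.X * S2 v₁) * (PowerSeries.X * S2 v₂) * (PowerSeries.X * S2 v₃) *
      (PowerSeries.X * S2 v₄) * (PowerSeries.X * S2 0) ^ 4 +
      (S3 v₁ * S3 v₂ * S3 v₃ * S3 v₄ * S3 0 ^ 4 + S4 v₁ * S4 v₂ * S4 v₃ * S4 v₄ * S4 0 ^ 4)) (by
    simp only [map_add, map_mul, map_pow, modTwo_S4, modTwo_S2_zero]
    linear_combination (modTwo (S3 v₁) * modTwo (S3 v₂) * modTwo (S3 v₃) * modTwo (S3 v₄) *
      modTwo (S3 0) ^ 4) * modTwo_two)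
  have hK0 := constantCoeff_eq_of_two_mul (P := 1) hK (by
    simp only [map_mul, map_add, map_pow, constantCoeff_S3, constantCoeff_S4, PowerSeries.constantCoeff_X]
    norm_num)
  have hε := neg_one_pow_four_squares hv
  have hz : HasZ (PowerSeries.X ^ (8 * 0) * K) (fun τ z =>
      (th2 v₁ τ z * th2 v₂ τ z * th2 v₃ τ z * th2 v₄ τ z * th2 0 τ z ^ 4 +
      (th3 v₁ τ z * th3 v₂ τ z * th3 v₃ τ z * th3 v₄ τ z * th3 0 τ z ^ 4 +
        th4 v₁ τ z * th4 v₂ τ z * th4 v₃ τ z * th4 v₄ τ z * th4 0 τ z ^ 4)) / 2) := by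
    rw [mul_zero, pow_zero, one_mul]
    refine HasZ.half ?_
    rw [← hK]
    exact (((((hasZ_S2 v₁).mul (hasZ_S2 v₂)).mul (hasZ_S2 v₃)).mul (hasZ_S2 v₄)).mul ((hasZ_S2 0).pow 4)).add
      ((((((hasZ_S3 v₁).mul (hasZ_S3 v₂)).mul (hasZ_S3 v₃)).mul (hasZ_S3 v₄)).mul ((hasZ_S3 0).pow 4)).add
        (((((hasZ_S4 v₁).mul (hasZ_S4 v₂)).mul (hasZ_S4 v₃)).mul (hasZ_S4 v₄)).mul ((hasZ_S4 0).pow 4)))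
  refine IJ.of_hasZ (w := 4) hz ?_ ?_ ?_ ?_ ?_ (by simp) (by rw [hK0]; exact coeff_two_mul_one)
  · intro τ z
    simp only [th2_T, th3_T, th4_T]
    linear_combination (th2 v₁ τ z * th2 v₂ τ z * th2 v₃ τ z * th2 v₄ τ z * th2 0 τ z ^ 4 / 2) *
      e2_eighth_pow_eight
  · intro τ z
    simp only [th2_add_one, th3_add_one, th4_add_one]
    linear_combination (th2 v₁ τ z * th2 v₂ τ z * th2 v₃ τ z * th2 v₄ τ z * th2 0 τ z ^ 4 / 2) * hε
  · intro τ z h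
    have hs := invFactor_pow_eight τ
    have hE := pow_four_squares hv (invExp τ z)
    simp only [th2_inv _ _ h, th3_inv _ _ h, th4_inv _ _ h]
    rw [← hE]
    generalize invExp τ z ^ v₁ ^ 2 = E₁
    generalize invExp τ z ^ v₂ ^ 2 = E₂
    generalize invExp τ z ^ v₃ ^ 2 = E₃
    generalize invExp τ z ^ v₄ ^ 2 = E₄
    linear_combination ((th2 v₁ τ z * th2 v₂ τ z * th2 v₃ τ z * th2 v₄ τ z * th2 0 τ z ^ 4 +
      (th3 v₁ τ z * th3 v₂ τ z * th3 v₃ τ z * th3 v₄ τ z * th3 0 τ z ^ 4 +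
        th4 v₁ τ z * th4 v₂ τ z * th4 v₃ τ z * th4 v₄ τ z * th4 0 τ z ^ 4)) / 2) *
      (E₁ * E₂ * E₃ * E₄) * hs
  · intro τ z
    have hE := pow_four_squares hv (ellFactor τ z)
    simp only [th2_add, th3_add, th4_add]
    rw [← hE]
    generalize ellFactor τ z ^ v₁ ^ 2 = E₁
    generalize ellFactor τ z ^ v₂ ^ 2 = E₂
    generalize ellFactor τ z ^ v₃ ^ 2 = E₃
    generalize ellFactor τ z ^ v₄ ^ 2 = E₄
    linear_combination (th4 v₁ τ z * th4 v₂ τ z * th4 v₃ τ z * th4 v₄ τ z * th4 0 τ z ^ 4 / 2) *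
      (E₁ * E₂ * E₃ * E₄) * hε
  · intro τ z
    simp only [th2_neg, th3_neg, th4_neg]

lemma IJ_A6_aux (hv : v₁ ^ 2 + v₂ ^ 2 + v₃ ^ 2 + v₄ ^ 2 = 2 * M) : IJ 6 M 0 1 := by
  obtain ⟨K, hK⟩ := two_dvd_of_modTwo
    (F := (PowerSeries.X * S2 v₁) * (PowerSeries.X * S2 v₂) * (PowerSeries.X * S2 v₃) *
      (PowerSeries.X * S2 v₄) * (S4 0 ^ 8 - S3 0 ^ 8) +
      (S3 v₁ * S3 v₂ * S3 v₃ * S3 v₄ * (S4 0 ^ 8 - (PowerSeries.X * S2 0) ^ 8) +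
        S4 v₁ * S4 v₂ * S4 v₃ * S4 v₄ * (S3 0 ^ 8 - (PowerSeries.X * S2 0) ^ 8))) (by
    simp only [map_add, map_sub, map_mul, map_pow, modTwo_S4, modTwo_S2_zero]
    linear_combination (modTwo (S3 v₁) * modTwo (S3 v₂) * modTwo (S3 v₃) * modTwo (S3 v₄) *
      modTwo (S3 0) ^ 8) * modTwo_two)
  have hK0 := constantCoeff_eq_of_two_mul (P := 1) hK (by
    simp only [map_mul, map_add, map_sub, map_pow, constantCoeff_S3, constantCoeff_S4,
      PowerSeries.constantCoeff_X]
    norm_num)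
  have hε := neg_one_pow_four_squares hv
  have hz : HasZ (PowerSeries.X ^ (8 * 0) * K) (fun τ z =>
      (th2 v₁ τ z * th2 v₂ τ z * th2 v₃ τ z * th2 v₄ τ z * (th4 0 τ z ^ 8 - th3 0 τ z ^ 8) +
      (th3 v₁ τ z * th3 v₂ τ z * th3 v₃ τ z * th3 v₄ τ z * (th4 0 τ z ^ 8 - th2 0 τ z ^ 8) +
        th4 v₁ τ z * th4 v₂ τ z * th4 v₃ τ z * th4 v₄ τ z * (th3 0 τ z ^ 8 - th2 0 τ z ^ 8))) / 2) := by
    rw [mul_zero, pow_zero, one_mul]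
    refine HasZ.half ?_
    rw [← hK]
    exact (((((hasZ_S2 v₁).mul (hasZ_S2 v₂)).mul (hasZ_S2 v₃)).mul (hasZ_S2 v₄)).mul
        (((hasZ_S4 0).pow 8).sub ((hasZ_S3 0).pow 8))).add
      ((((((hasZ_S3 v₁).mul (hasZ_S3 v₂)).mul (hasZ_S3 v₃)).mul (hasZ_S3 v₄)).mul
          (((hasZ_S4 0).pow 8).sub ((hasZ_S2 0).pow 8))).add
        (((((hasZ_S4 v₁).mul (hasZ_S4 v₂)).mul (hasZ_S4 v₃)).mul (hasZ_S4 v₄)).mul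
          (((hasZ_S3 0).pow 8).sub ((hasZ_S2 0).pow 8))))
  refine IJ.of_hasZ (w := 6) hz ?_ ?_ ?_ ?_ ?_ (by simp) (by rw [hK0]; exact coeff_two_mul_one)
  · intro τ z
    simp only [th2_T, th3_T, th4_T, mul_pow, e2_eighth_pow_eight]
    linear_combination (th2 v₁ τ z * th2 v₂ τ z * th2 v₃ τ z * th2 v₄ τ z *
      (th3 0 τ z ^ 8 - th4 0 τ z ^ 8) / 2) * e2_eighth_pow_four
  · intro τ z
    simp only [th2_add_one, th3_add_one, th4_add_one]
    linear_combination (th2 v₁ τ z * th2 v₂ τ z * th2 v₃ τ z * th2 v₄ τ z *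
      (th4 0 τ z ^ 8 - th3 0 τ z ^ 8) / 2) * hε
  · intro τ z h
    have hs := invFactor_pow_twelve τ
    have hE := pow_four_squares hv (invExp τ z)
    simp only [th2_inv _ _ h, th3_inv _ _ h, th4_inv _ _ h]
    rw [← hE]
    generalize invExp τ z ^ v₁ ^ 2 = E₁
    generalize invExp τ z ^ v₂ ^ 2 = E₂
    generalize invExp τ z ^ v₃ ^ 2 = E₃
    generalize invExp τ z ^ v₄ ^ 2 = E₄
    linear_combination -((th2 v₁ τ z * th2 v₂ τ z * th2 v₃ τ z * th2 v₄ τ z * (th4 0 τ z ^ 8 - th3 0 τ z ^ 8) +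
      (th3 v₁ τ z * th3 v₂ τ z * th3 v₃ τ z * th3 v₄ τ z * (th4 0 τ z ^ 8 - th2 0 τ z ^ 8) +
        th4 v₁ τ z * th4 v₂ τ z * th4 v₃ τ z * th4 v₄ τ z * (th3 0 τ z ^ 8 - th2 0 τ z ^ 8))) / 2) *
      (E₁ * E₂ * E₃ * E₄) * hs
  · intro τ z
    have hE := pow_four_squares hv (ellFactor τ z)
    simp only [th2_add, th3_add, th4_add]
    rw [← hE]
    generalize ellFactor τ z ^ v₁ ^ 2 = E₁
    generalize ellFactor τ z ^ v₂ ^ 2 = E₂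
    generalize ellFactor τ z ^ v₃ ^ 2 = E₃
    generalize ellFactor τ z ^ v₄ ^ 2 = E₄
    linear_combination (th4 v₁ τ z * th4 v₂ τ z * th4 v₃ τ z * th4 v₄ τ z *
      (th3 0 τ z ^ 8 - th2 0 τ z ^ 8) / 2) * (E₁ * E₂ * E₃ * E₄) * hε
  · intro τ z
    simp only [th2_neg, th3_neg, th4_neg]

end eisenstein

lemma IJ_A4 (M : ℕ) : IJ 4 M 0 1 := by
  obtain ⟨a, b, c, d, h⟩ := Nat.sum_four_squares (2 * M)
  exact IJ_A4_aux h

lemma IJ_A6 (M : ℕ) : IJ 6 M 0 1 := by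
  obtain ⟨a, b, c, d, h⟩ := Nat.sum_four_squares (2 * M)
  exact IJ_A6_aux h

/-- Integral Jacobi forms with constant term one exist in all even weights at least four. -/
lemma IJ_even (j M : ℕ) : IJ (4 + 2 * j) M 0 1 := by
  induction j using Nat.twoStepInduction generalizing M with
  | zero => simpa using IJ_A4 M
  | one => simpa using IJ_A6 M
  | more j ih _ =>
    exact ((ih M).mul (IJ_A4 0)).cast (by push_cast; ring) (by simp) (by simp) (by simp)

end forms

/-! ### Integral Jacobi forms with prescribed leading coefficient -/

section leading
open Polynomial

/-- There is an integral Jacobi form of weight `12 * M` and index `M` whose `q ^ M`-coefficient is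
`g + r * (ζ - 2 + ζ⁻¹) + ⋯`. -/
def HasLeading (M : ℕ) (g r : ℤ) : Prop :=
  ∃ Q : ℤ[X], IJ (12 * M) M M Q ∧ Q.coeff 0 = g ∧ Q.coeff 1 = r

namespace HasLeading
variable {M M' : ℕ} {g g' r r' : ℤ}

lemma mul (h : HasLeading M g r) (h' : HasLeading M' g' r') :
    HasLeading (M + M') (g * g') (g * r' + r * g') := by
  obtain ⟨Q, hQ, rfl, rfl⟩ := h
  obtain ⟨Q', hQ', rfl, rfl⟩ := h'
  exact ⟨Q * Q', (hQ.mul hQ').cast (by push_cast; ring) rfl rfl rfl, mul_coeff_zero _ _,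
    mul_coeff_one _ _⟩

lemma add (h : HasLeading M g r) (h' : HasLeading M g' r') :
    HasLeading M (g + g') (r + r') := by
  obtain ⟨Q, hQ, rfl, rfl⟩ := h
  obtain ⟨Q', hQ', rfl, rfl⟩ := h'
  exact ⟨Q + Q', hQ.add hQ', coeff_add _ _ _, coeff_add _ _ _⟩

lemma zsmul (a : ℤ) (h : HasLeading M g r) : HasLeading M (a * g) (a * r) := by
  obtain ⟨Q, hQ, rfl, rfl⟩ := h
  exact ⟨C a * Q, hQ.zsmul a, coeff_C_mul _, coeff_C_mul _⟩

lemma of_IJ {n : ℕ} {a : ℤ} (h : IJ 12 (n + 1) 1 (X + C a)) : HasLeading (n + 1) a 1 := by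
  refine ⟨X + C a, (h.mul (IJ_delta.pow n)).cast ?_ ?_ ?_ ?_, by simp, by
    rw [coeff_add, coeff_X_one, coeff_C_of_ne_zero one_ne_zero, add_zero]⟩
  · push_cast; ring
  · simp
  · ring
  · simp

lemma base : ∀ M : ℕ, 1 ≤ M → M ≤ 12 → ∃ g r : ℤ, IsCoprime g r ∧ HasLeading M g r ∧
    (M = 12 → g = 1) := by
  have D1 : HasLeading 1 12 1 := of_IJ (n := 0) IJ_D1
  have D2 : HasLeading 2 6 1 := of_IJ (n := 1) IJ_D2
  have D3 : HasLeading 3 4 1 := of_IJ (n := 2) IJ_D3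
  have D4 : HasLeading 4 3 1 := of_IJ (n := 3) IJ_D4
  have D6 : HasLeading 6 2 1 := of_IJ (n := 5) IJ_D6
  have G8 : HasLeading 8 3 2 := by
    simpa using (D6.mul D2).add ((D4.mul D4).zsmul (-1))
  have G9 := ((D4.mul D4).mul D1).add ((D6.mul D3).zsmul (-13))
  have G12 : HasLeading 12 1 1 := by
    simpa using (D4.mul G8).add ((D6.mul D6).zsmul (-2))
  intro M h1 h2
  interval_cases M
  · exact ⟨_, _, isCoprime_one_right, D1, by simp⟩
  · exact ⟨_, _, isCoprime_one_right, D2, by simp⟩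
  · exact ⟨_, _, isCoprime_one_right, D3, by simp⟩
  · exact ⟨_, _, isCoprime_one_right, D4, by simp⟩
  · exact ⟨_, _, by decide +kernel, (D4.mul D1).add ((D3.mul D2).zsmul (-1)), by simp⟩
  · exact ⟨_, _, isCoprime_one_right, D6, by simp⟩
  · exact ⟨_, _, by decide +kernel, D4.mul D3, by simp⟩
  · exact ⟨_, _, by decide +kernel, G8, by simp⟩
  · exact ⟨_, _, by decide +kernel, G9, by simp⟩
  · exact ⟨_, _, by decide +kernel, D6.mul D4, by simp⟩
  · exact ⟨_, _, by decide +kernel, G8.mul D3, by simp⟩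
  · exact ⟨_, _, isCoprime_one_right, G12, by simp⟩

lemma exists_coprime (M : ℕ) (hM : 1 ≤ M) : ∃ g r : ℤ, IsCoprime g r ∧ HasLeading M g r := by
  induction M using Nat.strong_induction_on with
  | _ M ih =>
    rcases le_or_gt M 12 with h | h
    · obtain ⟨g, r, h1, h2, -⟩ := base M hM h
      exact ⟨g, r, h1, h2⟩
    · obtain ⟨g, r, h1, h2⟩ := ih (M - 12) (by omega) (by omega)
      obtain ⟨g', r', -, h3, h4⟩ := base 12 (by norm_num) le_rfl
      obtain rfl := h4 rfl
      refine ⟨g, r + g * r', h1.add_mul_left_right r', ?_⟩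
      have := h2.mul h3
      rwa [Nat.sub_add_cancel h.le, mul_one, mul_one, add_comm] at this

end HasLeading

lemma IJ.of_coeff {w : ℤ} {m n : ℕ} (hmn : m ≤ n) {Q : ℤ[X]} (hd : Q.natDegree ≤ m)
    (hw : ∀ j, Q.coeff j ≠ 0 → ∃ i : ℕ, w + 2 * j = 12 * n + (4 + 2 * i)) : IJ w m n Q := by
  rw [Q.as_sum_range_C_mul_X_pow' (Nat.lt_succ_of_le hd)]
  refine IJ.sum _ fun j hj => ?_
  have hj : j ≤ m := by simpa [Nat.lt_succ_iff] using hj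
  by_cases h0 : Q.coeff j = 0
  · simpa [h0] using IJ.zero
  obtain ⟨i, hi⟩ := hw j h0
  refine IJ.zsmul _ ((((IJ_delta.pow (n - j)).mul (IJ_phi10.pow j)).mul (IJ_even i (m - j))).cast
    ?_ ?_ ?_ ?_)
  · push_cast [Nat.cast_sub (hj.trans hmn)]; linarith
  · simp [hj]
  · simp [hj.trans hmn]
  · simp

lemma IsJ.tay_eq_zero_of_low {w : ℤ} {m n : ℕ} {f : ℂ → ℂ → ℂ} {F : LaurentSeries₂ ℂ}
    (h : IsJ w m f F) (low : ∀ i < n, PowerSeries.coeff i F = 0) (a : ℕ)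
    (ha : w + 2 * a ≤ 12 * n + 1) (i : ℕ) :
    ∀ r < 2 * a, PowerSeries.coeff r (tay (PowerSeries.coeff i F)) = 0 := by
  induction a generalizing i with
  | zero => simp
  | succ a ih =>
    push_cast at ha
    exact h.tay_eq_zero (N := n) (fun i => ih (by linarith) i)
      (fun i hi => by rw [low i hi]; simp) (Or.inl (by linarith)) i

/-- `f` is a Jacobi form of shape `sig Q * q ^ n + O(q ^ (n + 1))`. -/
structure IsLead (w : ℤ) (m n : ℕ) (f : ℂ → ℂ → ℂ) (F : LaurentSeries₂ ℂ) (Q : ℤ[X]) : Prop where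
  isJ : IsJ w m f F
  low : ∀ i < n, PowerSeries.coeff i F = 0
  lead : PowerSeries.coeff n F = sig (Q.map (Int.castRingHom ℂ))

lemma coeff_toC (F : LaurentSeries₂ ℤ) (n : ℕ) : PowerSeries.coeff n (toC F) =
    AddMonoidAlgebra.mapRingHom ℤ (Int.castRingHom ℂ) (PowerSeries.coeff n F) :=
  PowerSeries.coeff_map _ _ _

lemma map_sig (Q : ℤ[X]) : AddMonoidAlgebra.mapRingHom ℤ (Int.castRingHom ℂ) (sig Q) =
    sig (Q.map (Int.castRingHom ℂ)) := by
  have : ((AddMonoidAlgebra.mapRingHom ℤ (Int.castRingHom ℂ)).comp (sig (R := ℤ))) =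
      (sig (R := ℂ)).comp (mapRingHom (Int.castRingHom ℂ)) := by
    apply Polynomial.ringHom_ext
    · intro a
      simp
    · have hT (n : ℤ) : AddMonoidAlgebra.mapRingHom ℤ (Int.castRingHom ℂ) (LaurentPolynomial.T n) =
          LaurentPolynomial.T n := by
        rw [LaurentPolynomial.T, LaurentPolynomial.T, AddMonoidAlgebra.mapRingHom_single, map_one]
      have h2 : (LaurentPolynomial.C 2 : LaurentPolynomial ℤ) = 2 := map_ofNat _ 2
      have h2' : (LaurentPolynomial.C 2 : LaurentPolynomial ℂ) = 2 := map_ofNat _ 2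
      rw [RingHom.comp_apply, RingHom.comp_apply, sig_X, coe_mapRingHom, map_X, sig_X, symS, symS,
        map_add, map_sub, hT, hT, h2, h2', map_ofNat]
  exact RingHom.congr_fun this Q

lemma IJ.exists_isLead {w : ℤ} {m n : ℕ} {Q : ℤ[X]} (h : IJ w m n Q) :
    ∃ f F, IsLead w m n f F Q := by
  obtain ⟨-, f, G, hf, hG⟩ := h
  refine ⟨f, _, hf, fun i hi => ?_, ?_⟩
  · rw [coeff_eq_zero_iff]
    intro l
    rw [cf_toC, cf_X_pow_mul, if_neg (by omega), Int.cast_zero]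
  · rw [← map_sig, ← hG, coeff_toC, PowerSeries.coeff_X_pow_mul', if_pos le_rfl, Nat.sub_self,
      PowerSeries.coeff_zero_eq_constantCoeff_apply]

namespace IsLead
variable {w : ℤ} {m n : ℕ} {f f' : ℂ → ℂ → ℂ} {F F' : LaurentSeries₂ ℂ} {Q Q' : ℤ[X]}

lemma smul (a : ℤ) (h : IsLead w m n f F Q) :
    IsLead w m n (fun τ z => a * f τ z) (cst (a : ℂ) * F) (C a * Q) where
  isJ := h.isJ.smul a
  low i hi := by rw [cst, RingHom.comp_apply, PowerSeries.coeff_C_mul, h.low i hi, mul_zero]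
  lead := by
    rw [cst, RingHom.comp_apply, PowerSeries.coeff_C_mul, h.lead, Polynomial.map_mul, map_C, map_mul,
      sig_C, eq_intCast]

lemma sub (h : IsLead w m n f F Q) (h' : IsLead w m n f' F' Q') :
    IsLead w m n (fun τ z => f τ z - f' τ z) (F - F') (Q - Q') where
  isJ := h.isJ.sub h'.isJ
  low i hi := by rw [map_sub, h.low i hi, h'.low i hi, sub_zero]
  lead := by rw [map_sub, h.lead, h'.lead, Polynomial.map_sub, map_sub]

lemma tay_eq_zero (h : IsLead w m n f F Q) (a : ℕ) (ha : w + 2 * a ≤ 12 * n + 1) (i : ℕ) :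
    ∀ r < 2 * a, PowerSeries.coeff r (tay (PowerSeries.coeff i F)) = 0 :=
  h.isJ.tay_eq_zero_of_low h.low a ha i

lemma coeff_eq_zero_of_tay (h : IsLead w m n f F Q) {a : ℕ}
    (ha : ∀ r < 2 * a, PowerSeries.coeff r (tay (PowerSeries.coeff n F)) = 0) {j : ℕ} (hj : j < a) :
    Q.coeff j = 0 := by
  rw [h.lead] at ha
  simpa using JacobiPaper.coeff_eq_zero_of_tay ha j hj

lemma coeff_eq_zero (h : IsLead w m n f F Q) {j : ℕ} (hj : w + 2 * j < 12 * n) : Q.coeff j = 0 :=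
  h.coeff_eq_zero_of_tay (h.tay_eq_zero (j + 1) (by push_cast; linarith) n) j.lt_succ_self

lemma coeff_zero_eq_zero (h : IsLead w m n f F Q) (hw : w = 12 * n + 2) : Q.coeff 0 = 0 :=
  h.coeff_eq_zero_of_tay (h.isJ.tay_eq_zero (j := 0) (N := n) (by simp)
    (fun i hi => by rw [h.low i hi]; simp) (Or.inr (by simpa using hw)) n) Nat.one_pos

lemma coeff_succ_eq_zero (h : IsLead w m n f F Q) {a : ℕ} (ha : w + 2 * a = 12 * n)
    (h0 : Q.coeff a = 0) : Q.coeff (a + 1) = 0 := by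
  have hlt : ∀ j < a, (Q.map (Int.castRingHom ℂ)).coeff j = 0 := fun j hj => by
    simp [h.coeff_eq_zero (j := j) (by have : (j : ℤ) < a := by exact_mod_cast hj
                                       linarith)]
  have h1 := h.isJ.tay_eq_zero (j := a) (N := n + 1) (h.tay_eq_zero a (by linarith))
    (fun i hi => by
      rcases (Nat.lt_succ_iff.1 hi).lt_or_eq with hi | rfl
      · rw [h.low i hi]; simp
      · rw [h.lead, (tay_sig_of_X_pow hlt).2]; simp [h0]) (Or.inl (by push_cast; linarith))
  exact h.coeff_eq_zero_of_tay (h.isJ.tay_eq_zero (j := a + 1) (N := n) h1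
    (fun i hi => by rw [h.low i hi]; simp) (Or.inr (by push_cast; linarith)) n) (a + 1).lt_succ_self

/-- Leading coefficients of Jacobi forms are leading coefficients of integral ones. -/
theorem IJ {K : ℤ} (hmn : m ≤ n) (hd : Q.natDegree ≤ m) (h : IsLead (2 * K) m n f F Q) :
    IJ (2 * K) m n Q := by
  have key (hK : ∀ j : ℕ, 6 * n - K + 2 > j → Q.coeff j = 0) : JacobiPaper.IJ (2 * K) m n Q := by
    refine IJ.of_coeff hmn hd fun j hj => ⟨(K + j - 6 * n - 2).toNat, ?_⟩
    have : ¬ 6 * (n : ℤ) - K + 2 > j := fun h => hj (hK j h)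
    rw [Int.toNat_of_nonneg (by linarith)]; ring
  rcases lt_or_ge (6 * (n : ℤ) - K) 0 with ha | ha
  · refine key fun j hj => ?_
    obtain rfl : j = 0 := by omega
    exact h.coeff_zero_eq_zero (by omega)
  obtain ⟨a, ha⟩ := Int.eq_ofNat_of_zero_le ha
  have hlow : ∀ j < a, Q.coeff j = 0 := fun j hj => h.coeff_eq_zero (by omega)
  rcases lt_trichotomy m a with hma | rfl | hma
  · have : Q = 0 := by
      ext j
      rcases lt_or_ge j a with hj | hj
      · rw [hlow j hj, Polynomial.coeff_zero]
      · rw [Polynomial.coeff_zero, Polynomial.coeff_eq_zero_of_natDegree_lt (by omega)]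
    rw [this]; exact IJ.zero
  · have : Q = C (Q.coeff m) * X ^ m := by
      ext j
      rw [coeff_C_mul_X_pow]
      split_ifs with hj
      · rw [hj]
      · rcases lt_or_gt_of_ne hj with hj | hj
        · exact hlow j hj
        · exact coeff_eq_zero_of_natDegree_lt (by omega)
    rw [this]
    refine IJ.zsmul _ (((IJ_delta.pow (n - m)).mul (IJ_phi10.pow m)).cast ?_ ?_ ?_ ?_)
    · push_cast [Nat.cast_sub hmn]; linarith
    · simp
    · simp [hmn]
    · simp
  obtain ⟨g, r, ⟨u, v, huv⟩, R, hR, rfl, rfl⟩ := HasLeading.exists_coprime (m - a) (by omega)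
  have hG : JacobiPaper.IJ (2 * K) m n (X ^ a * R) :=
    (((IJ_delta.pow (n - m)).mul (IJ_phi10.pow a)).mul hR).cast
      (by push_cast [Nat.cast_sub hmn, Nat.cast_sub hma.le]; linarith)
      (by simp [hma.le]) (by simp; omega) (by simp)
  obtain ⟨g, G, hgG⟩ := hG.exists_isLead
  have c0 : (X ^ a * R).coeff a = R.coeff 0 := by simpa using coeff_X_pow_mul R a 0
  have c1 : (X ^ a * R).coeff (a + 1) = R.coeff 1 := by
    simpa [add_comm] using coeff_X_pow_mul R a 1
  have hrel := ((h.smul (R.coeff 0)).sub (hgG.smul (Q.coeff a))).coeff_succ_eq_zero (a := a)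
    (by linarith) (by rw [coeff_sub, coeff_C_mul, coeff_C_mul, c0]; ring)
  rw [coeff_sub, coeff_C_mul, coeff_C_mul, c1] at hrel
  set t := u * Q.coeff a + v * Q.coeff (a + 1)
  have h0 : Q.coeff a = t * R.coeff 0 := by
    simp only [t]; linear_combination (-Q.coeff a) * huv - v * hrel
  have h1 : Q.coeff (a + 1) = t * R.coeff 1 := by
    simp only [t]; linear_combination (-Q.coeff (a + 1)) * huv + u * hrel
  have hsub : JacobiPaper.IJ (2 * K) m n (Q - C t * (X ^ a * R)) := by
    refine IJ.of_coeff hmn ?_ fun j hj => ⟨(K + j - 6 * n - 2).toNat, ?_⟩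
    · exact (natDegree_sub_le _ _).trans (max_le hd ((hG.zsmul t).1))
    have : a + 2 ≤ j := by
      by_contra hlt
      apply hj
      rw [coeff_sub, coeff_C_mul]
      rcases lt_trichotomy j a with hja | rfl | hja
      · rw [hlow j hja, coeff_X_pow_mul', if_neg (by omega), mul_zero, sub_zero]
      · rw [c0, h0, sub_self]
      · obtain rfl : j = a + 1 := by omega
        rw [c1, h1, sub_self]
    rw [Int.toNat_of_nonneg (by omega)]; ring
  simpa using hsub.add (hG.zsmul t)

end IsLead
end leading

/-! ### The integrality criterion for Jacobi forms -/

/-- Laurent polynomials with integral coefficients. -/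
def intLaurent : Subring (LaurentPolynomial ℂ) :=
  (AddMonoidAlgebra.mapRingHom ℤ (Int.castRingHom ℂ)).range

lemma mem_intLaurent {P : LaurentPolynomial ℂ} :
    P ∈ intLaurent ↔ ∀ l, ∃ a : ℤ, P.coeff l = a := by
  refine ⟨?_, fun h => ⟨AddMonoidAlgebra.ofCoeff
    (P.coeff.mapRange (fun x : ℂ => ⌊x.re⌋) (by simp)), ?_⟩⟩
  · rintro ⟨P, rfl⟩ l
    exact ⟨P.coeff l, by simp⟩
  · ext l
    obtain ⟨a, ha⟩ := h l
    simp [ha]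

lemma coeff_toC_mem (G : LaurentSeries₂ ℤ) (n : ℕ) : PowerSeries.coeff n (toC G) ∈ intLaurent :=
  ⟨PowerSeries.coeff n G, (coeff_toC G n).symm⟩

lemma coeff_mul_mem {F G : LaurentSeries₂ ℂ} {n : ℕ}
    (hF : ∀ i ≤ n, PowerSeries.coeff i F ∈ intLaurent)
    (hG : ∀ i ≤ n, PowerSeries.coeff i G ∈ intLaurent) : PowerSeries.coeff n (F * G) ∈ intLaurent := by
  rw [PowerSeries.coeff_mul]
  refine Subring.sum_mem _ fun p hp => ?_
  have := Finset.HasAntidiagonal.mem_antidiagonal.1 hp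
  exact mul_mem (hF _ (by omega)) (hG _ (by omega))

namespace IsJ
variable {K : ℤ} {m : ℕ} {f : ℂ → ℂ → ℂ} {F : LaurentSeries₂ ℂ}

lemma coeff_eq_zero {w : ℤ} {n : ℕ} (h : IsJ w m f F)
    (low : ∀ i < n, PowerSeries.coeff i F = 0) (hn : w + 2 * m < 12 * n) :
    PowerSeries.coeff n F = 0 := by
  obtain ⟨Q, hd, hQ⟩ := h.exists_leading (n := n) (fun i hi => coeff_eq_zero_iff.1 (low i hi))
    (φ := RingHom.id ℂ) Function.injective_id (P := PowerSeries.coeff n F) (fun l => rfl)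
  have ht := h.tay_eq_zero_of_low low (m + 1) (by push_cast; linarith) n
  rw [hQ] at ht
  have : Q = 0 := by
    ext j
    rcases lt_or_ge j (m + 1) with hj | hj
    · simpa using coeff_eq_zero_of_tay ht j hj
    · rw [Polynomial.coeff_zero, Polynomial.coeff_eq_zero_of_natDegree_lt (by omega)]
  rw [hQ, this, map_zero]

lemma coeff_mem_of_low (h : IsJ (2 * K) m f F) (low : ∀ i < m, PowerSeries.coeff i F = 0)
    (hint : ∀ n : ℕ, 6 * n ≤ K + m → PowerSeries.coeff n F ∈ intLaurent) (n : ℕ) :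
    PowerSeries.coeff n F ∈ intLaurent := by
  have key (d : ℕ) : ∃ (g : ℂ → ℂ → ℂ) (G : LaurentSeries₂ ℤ), IsJ (2 * K) m g (toC G) ∧
      ∀ i < m + d, PowerSeries.coeff i F = PowerSeries.coeff i (toC G) := by
    induction d with
    | zero => exact ⟨_, 0, by simpa using IsJ.zero, fun i hi => by rw [low i hi]; simp⟩
    | succ d ih =>
      obtain ⟨g, G, hg, hG⟩ := ih
      have hs := h.sub hg
      have low' : ∀ i < m + d, PowerSeries.coeff i (F - toC G) = 0 := fun i hi => by
        rw [map_sub, hG i hi, sub_self]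
      rcases le_or_gt (6 * ((m + d : ℕ) : ℤ)) (K + m) with hd | hd
      · obtain ⟨P, hP⟩ : PowerSeries.coeff (m + d) (F - toC G) ∈ intLaurent := by
          rw [map_sub]; exact sub_mem (hint _ hd) (coeff_toC_mem _ _)
        obtain ⟨Q, hQd, rfl⟩ := hs.exists_leading (n := m + d)
          (fun i hi => coeff_eq_zero_iff.1 (low' i hi)) (φ := Int.castRingHom ℂ)
          Int.cast_injective (P := P) (fun l => by rw [cf, ← hP]; simp)
        obtain ⟨-, g', G', hg', hG'⟩ :=
          IsLead.IJ (by omega) hQd ⟨hs, low', by rw [← hP, map_sig]⟩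
        refine ⟨_, G + PowerSeries.X ^ (m + d) * G', by rw [map_add]; exact hg.add hg', fun i hi => ?_⟩
        rw [map_add, map_add, coeff_toC (_ * _), PowerSeries.coeff_X_pow_mul', ← sub_eq_iff_eq_add',
          ← map_sub]
        rcases (show i < m + d ∨ i = m + d by omega) with hi | rfl
        · rw [low' i hi, if_neg (by omega), map_zero]
        · rw [if_pos le_rfl, Nat.sub_self, PowerSeries.coeff_zero_eq_constantCoeff_apply, hG', ← hP]
      · refine ⟨g, G, hg, fun i hi => ?_⟩
        rcases (show i < m + d ∨ i = m + d by omega) with hi | rfl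
        · exact hG i hi
        · rw [← sub_eq_zero, ← map_sub]
          exact hs.coeff_eq_zero low' (by linarith)
  obtain ⟨g, G, -, hG⟩ := key (n + 1)
  rw [hG n (by omega)]
  exact coeff_toC_mem _ _

/-- A Jacobi form of weight `2 * K` and index `m` has integral Fourier coefficients as soon as its
coefficients of `q ^ n` for `n ≤ (K + m) / 6` are integral. -/
theorem coeff_mem (h : IsJ (2 * K) m f F)
    (hint : ∀ n : ℕ, 6 * n ≤ K + m → PowerSeries.coeff n F ∈ intLaurent) (n : ℕ) :
    PowerSeries.coeff n F ∈ intLaurent := by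
  obtain ⟨-, δ, D, hD, hD1⟩ := IJ_delta.pow m
  rw [one_pow, map_one] at hD1
  rw [mul_one, mul_zero] at hD
  obtain ⟨E, hE⟩ : IsUnit D := PowerSeries.isUnit_iff_constantCoeff.2 (hD1 ▸ isUnit_one)
  have hprod : IsJ (2 * (K + 6 * m)) m (fun τ z => δ τ z * f τ z)
      (PowerSeries.X ^ m * (toC D * F)) := by
    have := hD.mul h
    rw [zero_add, map_mul, map_pow, toC_X, mul_assoc] at this
    convert this using 1
    ring
  have hDF (n : ℕ) : PowerSeries.coeff n (toC D * F) ∈ intLaurent := by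
    have := hprod.coeff_mem_of_low (fun i hi => by
      rw [PowerSeries.coeff_X_pow_mul', if_neg (by omega)]) (fun i hi => ?_) (n + m)
    · rwa [PowerSeries.coeff_X_pow_mul] at this
    · rw [PowerSeries.coeff_X_pow_mul']
      split_ifs with him
      · exact coeff_mul_mem (fun j _ => coeff_toC_mem _ _) (fun j hj => hint j (by omega))
      · exact zero_mem _
  have : F = toC (↑E⁻¹ : LaurentSeries₂ ℤ) * (toC D * F) := by
    rw [← mul_assoc, ← map_mul, ← hE, Units.inv_mul, map_one, one_mul]
  rw [this]
  exact coeff_mul_mem (fun j _ => coeff_toC_mem _ _) (fun j _ => hDF j)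

end IsJ

/-! ### Fourier–Jacobi expansion of Siegel modular forms -/

/-- Extracting a Fourier–Jacobi coefficient. -/
lemma hasSum_fourierJacobi {b : ℕ × ℤ × ℕ → ℂ} {ψ : ℂ → ℂ} {τ z t : ℂ}
    (h : ∀ x : ℝ, HasSum (fun p : ℕ × ℤ × ℕ => b p * e2 (p.1 * τ + p.2.1 * z + p.2.2 * (x + t)))
      (ψ (x + t))) (m : ℕ) :
    HasSum (fun p : ℕ × ℤ => b (p.1, p.2, m) * e2 (p.1 * τ + p.2 * z))
      (∫ x in (0 : ℝ)..1, ψ (x + t) * e2 (-(m * (x + t)))) := by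
  have h1 := hasSum_fourierCoeff (a := fun p : ℕ × ℤ × ℕ => b p * e2 (p.1 * τ + p.2.1 * z + p.2.2 * t))
    (k := fun p => p.2.2) (g := fun x => ψ (x + t)) (fun x => hasSum_of_eq (h x) fun p => by
      rw [mul_assoc, ← e2_add]; congr 2; push_cast; ring) m
  have hi : Function.Injective fun p : ℕ × ℤ => (p.1, p.2, m) := fun p q h => by
    simp only [Prod.mk.injEq, and_true] at h
    exact Prod.ext h.1 h.2
  have h2 := ((hi.hasSum_iff (fun p hp => if_neg fun hm => hp ⟨(p.1, p.2.1), by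
    ext <;> simp; exact_mod_cast hm.symm⟩)).2 h1).mul_right (e2 (-(m * t)))
  have h3 : ∫ x in (0 : ℝ)..1, ψ (x + t) * e2 (-(m * (x + t))) =
      (∫ x in (0 : ℝ)..1, ψ (x + t) * e2 (-(((m : ℤ) : ℂ) * x))) * e2 (-(m * t)) := by
    rw [← intervalIntegral.integral_mul_const]
    congr 1; funext x
    rw [mul_assoc, ← e2_add]; congr 2; push_cast; ring
  rw [h3]
  refine hasSum_of_eq h2 fun p => ?_
  simp only [Function.comp, if_true]
  rw [mul_assoc, ← e2_add]; congr 2; ring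

namespace IsSiegelModularForm2
variable {w : ℤ} {Φ : ℂ → ℂ → ℂ → ℂ} {c : ℕ → ℤ → ℕ → ℂ}

lemma apply_eq (h : IsSiegelModularForm2 w Φ c) {A B C D : Matrix (Fin 2) (Fin 2) ℤ}
    (h1 : A.transpose * C = C.transpose * A) (h2 : B.transpose * D = D.transpose * B)
    (h3 : A.transpose * D - C.transpose * B = 1) {τ₁ z τ₂ : ℂ} (hτ : 0 < τ₁.im)
    (hz : 0 < τ₁.im * τ₂.im - z.im ^ 2) {a b d j : ℂ} (hj : j ≠ 0)
    (hdet : (C.map (Int.cast : ℤ → ℂ) * !![τ₁, z; z, τ₂] + D.map (Int.cast : ℤ → ℂ)).det = j)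
    (hZ : !![a, b; b, d] * (C.map (Int.cast : ℤ → ℂ) * !![τ₁, z; z, τ₂] + D.map (Int.cast : ℤ → ℂ)) =
      A.map (Int.cast : ℤ → ℂ) * !![τ₁, z; z, τ₂] + B.map (Int.cast : ℤ → ℂ)) :
    Φ a b d = j ^ w * Φ τ₁ z τ₂ := by
  have := h.2.1 A B C D h1 h2 h3 τ₁ z τ₂ hτ hz !![a, b; b, d] (by
    rw [← hZ, Matrix.mul_nonsing_inv_cancel_right]
    rw [hdet]; exact hj.isUnit)
  rw [hdet] at this
  simpa using this

lemma inv (h : IsSiegelModularForm2 w Φ c) {τ₁ z τ₂ : ℂ} (hτ : 0 < τ₁.im)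
    (hz : 0 < τ₁.im * τ₂.im - z.im ^ 2) :
    Φ (-1 / τ₁) (z / τ₁) (τ₂ - z ^ 2 / τ₁) = τ₁ ^ w * Φ τ₁ z τ₂ := by
  have h0 := ne_zero_of_im_pos hτ
  refine h.apply_eq (A := !![0, 0; 0, 1]) (B := !![-1, 0; 0, 0]) (C := !![1, 0; 0, 0])
    (D := !![0, 0; 0, 1]) (by decide) (by decide) (by decide) hτ hz h0 ?_ ?_
  · simp [Matrix.det_fin_two, Matrix.mul_apply, Fin.sum_univ_two]
  · ext i j; fin_cases i <;> fin_cases j <;>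
      simp [Matrix.mul_apply, Fin.sum_univ_two] <;> field_simp <;> ring

lemma ell (h : IsSiegelModularForm2 w Φ c) {τ₁ z τ₂ : ℂ} (hτ : 0 < τ₁.im)
    (hz : 0 < τ₁.im * τ₂.im - z.im ^ 2) :
    Φ τ₁ (z + τ₁) (τ₂ + 2 * z + τ₁) = Φ τ₁ z τ₂ := by
  have := h.apply_eq (A := !![1, 0; 1, 1]) (B := 0) (C := 0)
    (D := !![1, -1; 0, 1]) (by decide) (by decide) (by decide) hτ hz one_ne_zero
    (a := τ₁) (b := z + τ₁) (d := τ₂ + 2 * z + τ₁) ?_ ?_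
  · simpa using this
  · simp [Matrix.det_fin_two]
  · ext i j; fin_cases i <;> fin_cases j <;>
      simp [Matrix.mul_apply, Fin.sum_univ_two] <;> ring

lemma neg (h : IsSiegelModularForm2 w Φ c) (hw : Even w) {τ₁ z τ₂ : ℂ} (hτ : 0 < τ₁.im)
    (hz : 0 < τ₁.im * τ₂.im - z.im ^ 2) : Φ τ₁ (-z) τ₂ = Φ τ₁ z τ₂ := by
  have := h.apply_eq (A := !![1, 0; 0, -1]) (B := 0) (C := 0)
    (D := !![1, 0; 0, -1]) (by decide) (by decide) (by decide) hτ hz (neg_ne_zero.2 one_ne_zero)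
    (a := τ₁) (b := -z) (d := τ₂) ?_ ?_
  · simpa [hw.neg_zpow] using this
  · simp [Matrix.det_fin_two]
  · ext i j; fin_cases i <;> fin_cases j <;> simp [Matrix.mul_apply, Fin.sum_univ_two]

lemma swap (h : IsSiegelModularForm2 w Φ c) (hw : Even w) {τ₁ z τ₂ : ℂ} (hτ : 0 < τ₁.im)
    (hz : 0 < τ₁.im * τ₂.im - z.im ^ 2) : Φ τ₂ z τ₁ = Φ τ₁ z τ₂ := by
  have := h.apply_eq (A := !![0, 1; 1, 0]) (B := 0) (C := 0)
    (D := !![0, 1; 1, 0]) (by decide) (by decide) (by decide) hτ hz (neg_ne_zero.2 one_ne_zero)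
    (a := τ₂) (b := z) (d := τ₁) ?_ ?_
  · simpa [hw.neg_zpow] using this
  · simp [Matrix.det_fin_two]
  · ext i j; fin_cases i <;> fin_cases j <;> simp [Matrix.mul_apply, Fin.sum_univ_two]

lemma hasSum_coeff (h : IsSiegelModularForm2 w Φ c) (m : ℕ) {τ z t : ℂ} (hτ : 0 < τ.im)
    (hz : 0 < τ.im * t.im - z.im ^ 2) :
    HasSum (fun p : ℕ × ℤ => c p.1 p.2 m * e2 (p.1 * τ + p.2 * z))
      (∫ x in (0 : ℝ)..1, Φ τ z (x + t) * e2 (-(m * (x + t)))) :=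
  hasSum_fourierJacobi (b := fun p => c p.1 p.2.1 p.2.2) (ψ := Φ τ z) (fun x =>
    h.2.2.2 τ z (x + t) hτ (by simpa using hz)) m

lemma exists_height {τ z : ℂ} (hτ : 0 < τ.im) : ∃ t : ℂ, 0 < τ.im * t.im - z.im ^ 2 := by
  refine ⟨((z.im ^ 2 + 1) / τ.im : ℝ) * I, ?_⟩
  rw [im_ofReal_mul, I_im, mul_one, mul_div_cancel₀ _ hτ.ne']; linarith

lemma im_neg_one_div_pos {τ : ℂ} (hτ : 0 < τ.im) : 0 < (-1 / τ).im := by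
  have := normSq_pos.2 (ne_zero_of_im_pos hτ)
  rw [neg_div, one_div, neg_im, inv_im, neg_div, neg_neg]
  positivity

lemma height_inv {τ z t : ℂ} (hτ : 0 < τ.im) (hz : 0 < τ.im * t.im - z.im ^ 2) :
    0 < (-1 / τ).im * (t - z ^ 2 / τ).im - (z / τ).im ^ 2 := by
  have h0 := ne_zero_of_im_pos hτ
  have hN := normSq_pos.2 h0
  obtain ⟨s, rfl⟩ : ∃ s, z = s * τ := ⟨z / τ, by field_simp⟩
  rw [show (s * τ) ^ 2 / τ = s ^ 2 * τ by field_simp, mul_div_cancel_right₀ _ h0, neg_div, one_div,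
    neg_im, inv_im, neg_div, neg_neg]
  refine (div_pos hz hN).trans_eq ?_
  field_simp
  simp only [normSq_apply, sub_im, mul_im, pow_two, mul_re]
  ring

/-- The Fourier–Jacobi coefficient of index `m`, as a function. -/
def fourierJacobi (c : ℕ → ℤ → ℕ → ℂ) (m : ℕ) (τ z : ℂ) : ℂ :=
  ∑' p : ℕ × ℤ, c p.1 p.2 m * e2 (p.1 * τ + p.2 * z)

lemma fourierJacobi_eq (h : IsSiegelModularForm2 w Φ c) (m : ℕ) {τ z t : ℂ} (hτ : 0 < τ.im)
    (hz : 0 < τ.im * t.im - z.im ^ 2) : fourierJacobi c m τ z =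
      ∫ x in (0 : ℝ)..1, Φ τ z (x + t) * e2 (-(m * (x + t))) := (h.hasSum_coeff m hτ hz).tsum_eq

lemma coeff_swap (h : IsSiegelModularForm2 w Φ c) (hw : Even w) (n : ℕ) (l : ℤ) (m : ℕ) :
    c n l m = c m l n := by
  have h1 (τ z : ℂ) (hτ : 0 < τ.im) :
      HasSum (fun p : ℕ × ℤ => c p.1 p.2 m * e2 ((p.1 : ℤ) * τ + p.2 * z)) (fourierJacobi c m τ z) := by
    obtain ⟨t, ht⟩ := exists_height (z := z) hτ
    simpa [fourierJacobi] using (h.hasSum_coeff m hτ ht).summable.hasSum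
  have h2 (τ z : ℂ) (hτ : 0 < τ.im) :
      HasSum (fun p : ℕ × ℤ => c m p.2 p.1 * e2 ((p.1 : ℤ) * τ + p.2 * z)) (fourierJacobi c m τ z) := by
    obtain ⟨t, ht⟩ := exists_height (z := z) hτ
    rw [h.fourierJacobi_eq m hτ ht]
    have := hasSum_fourierJacobi (b := fun p => c p.2.2 p.2.1 p.1) (ψ := Φ τ z) (τ := τ) (z := z)
      (t := t) (fun x => ?_) m
    · simpa using this
    have ht' : 0 < ((x : ℂ) + t).im := by
      have : ((x : ℂ) + t).im = t.im := by simp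
      rw [this]
      by_contra hn
      nlinarith [sq_nonneg z.im, not_lt.1 hn]
    have hz : 0 < τ.im * ((x : ℂ) + t).im - z.im ^ 2 := by simpa using ht
    rw [← h.swap hw hτ hz]
    let e : ℕ × ℤ × ℕ ≃ ℕ × ℤ × ℕ := ⟨fun p => (p.2.2, p.2.1, p.1), fun p => (p.2.2, p.2.1, p.1),
      fun _ => rfl, fun _ => rfl⟩
    refine hasSum_of_eq (e.hasSum_iff.2 (h.2.2.2 _ z τ ht' (by rwa [mul_comm]))) fun p => ?_
    simp only [Function.comp, e, Equiv.coe_fn_mk]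
    congr 2; ring
  exact fourier_unique h1 h2 (n, l)

/-- The Fourier–Jacobi coefficient of index `m`, as a formal series. -/
lemma exists_series (h : IsSiegelModularForm2 w Φ c) (m : ℕ) :
    ∃ F : LaurentSeries₂ ℂ, ∀ n l, cf F n l = c n l m := by
  refine ⟨PowerSeries.mk fun n => AddMonoidAlgebra.ofCoeff
    (Finsupp.onFinset (Finset.Icc (-(4 * n * m : ℤ)) (4 * n * m)) (fun l => c n l m)
      fun l hl => ?_), fun n l => by simp [cf, PowerSeries.coeff_mk]⟩
  have := not_lt.1 fun hlt => hl (h.2.2.1 n m l hlt)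
  rw [Finset.mem_Icc]
  constructor <;> nlinarith [sq_nonneg (l + 1), sq_nonneg (l - 1)]

lemma isJ (h : IsSiegelModularForm2 w Φ c) (hw : Even w) {m : ℕ} {F : LaurentSeries₂ ℂ}
    (hF : ∀ n l, cf F n l = c n l m) : IsJ w m (fourierJacobi c m) F where
  ev τ z hτ := by
    obtain ⟨t, ht⟩ := exists_height (z := z) hτ
    refine hasSum_of_eq (h.hasSum_coeff m hτ ht).summable.hasSum fun p => ?_
    rw [hF, e2_lin, Int.cast_natCast]
  inv τ z hτ := by
    obtain ⟨t, ht⟩ := exists_height (z := z) hτ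
    have h0 := ne_zero_of_im_pos hτ
    rw [h.fourierJacobi_eq m hτ ht, h.fourierJacobi_eq m (t := t - z ^ 2 / τ) (im_neg_one_div_pos hτ)
      (height_inv hτ ht), ← intervalIntegral.integral_const_mul]
    congr 1; funext x
    rw [← add_sub_assoc, h.inv hτ (by simpa using ht), show τ ^ w * e2 (m * z ^ 2 / τ) *
      (Φ τ z (x + t) * e2 (-(m * (x + t)))) = τ ^ w * Φ τ z (x + t) *
        (e2 (m * z ^ 2 / τ) * e2 (-(m * (x + t)))) by ring, ← e2_add]
    congr 2; ring
  ell τ z hτ := by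
    obtain ⟨t, ht⟩ := exists_height (z := z) hτ
    rw [h.fourierJacobi_eq m hτ ht, h.fourierJacobi_eq m (t := t + 2 * z + τ) hτ ?_,
      ← intervalIntegral.integral_const_mul]
    · congr 1; funext x
      rw [show (x : ℂ) + (t + 2 * z + τ) = x + t + 2 * z + τ by ring, h.ell hτ (by simpa using ht),
        mul_left_comm, ← e2_add]
      congr 2; ring
    · simp; nlinarith
  par τ z hτ := by
    obtain ⟨t, ht⟩ := exists_height (z := z) hτ
    rw [h.fourierJacobi_eq m hτ ht, h.fourierJacobi_eq m (t := t) hτ (by simpa using ht)]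
    congr 1; funext x
    rw [h.neg hw hτ (by simpa using ht)]

/-- The coefficients of index `m` of a Siegel modular form of weight `2 * k` are integral as soon
as those with `n ≤ (k + m) / 6` are. -/
lemma integral_of_low {k : ℤ} (h : IsSiegelModularForm2 (2 * k) Φ c) {m : ℕ}
    (hlow : ∀ n : ℕ, ∀ l : ℤ, 6 * n ≤ k + m → ∃ a : ℤ, c n l m = a) (n : ℕ) (l : ℤ) :
    ∃ a : ℤ, c n l m = a := by
  obtain ⟨F, hF⟩ := h.exists_series m
  rw [← hF]
  exact mem_intLaurent.1 ((h.isJ (even_two_mul k) hF).coeff_mem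
    (fun i hi => mem_intLaurent.2 fun l => by simpa [← hF, cf] using hlow i l hi) n) l

end IsSiegelModularForm2

/-- Theorem 3.4 of Gritsenko–Wang: let `Φ` be a Siegel modular form of genus
`2` and weight `2k` with Fourier coefficients `c(n,l,m)`. If `c(n,l,m) ∈ ℤ` for all
`m ≤ ⌊(k+1)/5⌋`, `n ≤ ⌊(k+m)/6⌋` and `l² ≤ 4nm`, then all `c(n,l,m)` with `4nm ≥ l²` are
integers. -/
theorem integrality_criterion_siegel (k : ℕ) (Φ : ℂ → ℂ → ℂ → ℂ) (c : ℕ → ℤ → ℕ → ℂ)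
    (hΦ : IsSiegelModularForm2 (2 * k) Φ c)
    (hint : ∀ n m : ℕ, ∀ l : ℤ, m ≤ (k + 1) / 5 → n ≤ (k + m) / 6 →
      l ^ 2 ≤ 4 * (n : ℤ) * (m : ℤ) → ∃ a : ℤ, c n l m = (a : ℂ)) :
    ∀ n m : ℕ, ∀ l : ℤ, l ^ 2 ≤ 4 * (n : ℤ) * (m : ℤ) → ∃ a : ℤ, c n l m = (a : ℂ) := by
  suffices H : ∀ m n : ℕ, ∀ l : ℤ, ∃ a : ℤ, c n l m = (a : ℂ) from fun n m l _ => H m n l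
  intro m
  induction m using Nat.strong_induction_on with
  | _ m ih =>
    refine hΦ.integral_of_low fun n l hn => ?_
    rcases le_or_gt m ((k + 1) / 5) with hm | hm
    · rcases le_or_gt (l ^ 2) (4 * (n : ℤ) * (m : ℤ)) with hl | hl
      · exact hint n m l hm (by omega) hl
      · exact ⟨0, by rw [hΦ.2.2.1 n m l hl, Int.cast_zero]⟩
    · rw [hΦ.coeff_swap (even_two_mul _)]
      exact ih n (by omega) m l


end JacobiPaper
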